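/- arXiv:1510.01619 — 4 statements merged into one kernel-verified Lean document; each statement's English description precedes it below -/
import Mathlib

section
/- Let s > 0 be a real number and let ζ denote the Riemann zeta function (analytically continued). Then there exists a constant C > 0 such that for all integers n ≥ 1, |∑_{k=1}^{n} k^s − (ζ(−s) + n^{1+s}/(1+s) + n^s/2 + (s/12) n^{s−1})| ≤ C n^{s−3}. -/
/-- The Riemann zeta function (analytically continued), viewed as a real-valued
function of a real argument (its values at real points away from 1 are real). -/
noncomputable def zetaR (s : ℝ) : ℝ := (riemannZeta (s : ℂ)).re

namespace SPE
open Complex Filter Topology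

/-- partial expression -/
noncomputable def W (n : ℕ) (z : ℂ) : ℂ :=
  (n : ℂ) ^ (1 - z) + (1 - z) * (n : ℂ) ^ (-z) / 2 - z * (1 - z) / 12 * (n : ℂ) ^ (-z - 1)

noncomputable def T (n : ℕ) (z : ℂ) : ℂ :=
  (1 - z) * (∑ k ∈ Finset.range n, ((k + 1 : ℕ) : ℂ) ^ (-z)) - W n z

noncomputable def c5 (z : ℂ) : ℂ := (1 - z) * (-z) * (-z - 1) * (-z - 2) * (-z - 3)

/-- Primitive used in the Euler–Maclaurin step. -/
noncomputable def Q (x : ℂ) (z : ℂ) (t : ℂ) : ℂ :=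
  (t ^ 2 - 2 * t ^ 3 + t ^ 4) / 24 *
      ((1 - z) * (-z) * (-z - 1) * (-z - 2) * (x + t) ^ (-z - 3))
    - (2 * t - 6 * t ^ 2 + 4 * t ^ 3) / 24 * ((1 - z) * (-z) * (-z - 1) * (x + t) ^ (-z - 2))
    + (2 - 12 * t + 12 * t ^ 2) / 24 * ((1 - z) * (-z) * (x + t) ^ (-z - 1))
    - (-12 + 24 * t) / 24 * ((1 - z) * (x + t) ^ (-z))
    + (x + t) ^ (1 - z)

lemma Q_deriv (x z t : ℂ) (h : x + t ∈ slitPlane) :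
    HasDerivAt (Q x z) ((t ^ 2 - 2 * t ^ 3 + t ^ 4) / 24 * (c5 z * (x + t) ^ (-z - 4))) t := by
  have hp : ∀ w : ℂ, HasDerivAt (fun u : ℂ => (x + u) ^ w) (w * (x + t) ^ (w - 1)) t := by
    intro w
    simpa using ((hasDerivAt_id t).const_add x).cpow_const (c := w) h
  have q : ∀ n : ℕ, HasDerivAt (fun u : ℂ => u ^ n) (n * t ^ (n - 1)) t := fun n => by
    simpa using hasDerivAt_pow n t
  have i1 := (hasDerivAt_id' t)
  have p0 : HasDerivAt (fun t : ℂ => (t ^ 2 - 2 * t ^ 3 + t ^ 4) / 24)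
      ((2 * t - 6 * t ^ 2 + 4 * t ^ 3) / 24) t := by
    refine ((((q 2).sub ((q 3).const_mul 2)).add (q 4)).div_const 24).congr_deriv ?_
    norm_num; ring
  have p1 : HasDerivAt (fun t : ℂ => (2 * t - 6 * t ^ 2 + 4 * t ^ 3) / 24)
      ((2 - 12 * t + 12 * t ^ 2) / 24) t := by
    refine ((((i1.const_mul 2).sub ((q 2).const_mul 6)).add
      ((q 3).const_mul 4)).div_const 24).congr_deriv ?_
    norm_num; ring
  have p2 : HasDerivAt (fun t : ℂ => (2 - 12 * t + 12 * t ^ 2) / 24)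
      ((-12 + 24 * t) / 24) t := by
    refine ((((i1.const_mul 12).const_sub 2).add
      ((q 2).const_mul 12)).div_const 24).congr_deriv ?_
    norm_num; ring
  have p3 : HasDerivAt (fun t : ℂ => (-12 + 24 * t) / 24) 1 t := by
    refine (((i1.const_mul 24).const_add (-12)).div_const 24).congr_deriv ?_
    norm_num
  have key := ((((p0.mul ((hp (-z - 3)).const_mul ((1 - z) * (-z) * (-z - 1) * (-z - 2)))).sub
    (p1.mul ((hp (-z - 2)).const_mul ((1 - z) * (-z) * (-z - 1))))).add
    (p2.mul ((hp (-z - 1)).const_mul ((1 - z) * (-z))))).sub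
    (p3.mul ((hp (-z)).const_mul ((1 - z))))).add (hp (1 - z))
  refine key.congr_deriv ?_
  rw [show -z - 3 - 1 = -z - 4 by ring, show -z - 2 - 1 = -z - 3 by ring,
    show -z - 1 - 1 = -z - 2 by ring, show 1 - z - 1 = -z by ring, c5]
  ring

lemma T_succ_sub (n : ℕ) (z : ℂ) : T (n + 1) z - T n z = -(Q n z 1 - Q n z 0) := by
  simp only [T, Q, W, Finset.sum_range_succ]
  push_cast
  simp only [add_zero]
  ring

lemma step_bound (n : ℕ) (hn : 1 ≤ n) (z : ℂ) (B B' : ℝ → ℝ) (hB0 : B 0 = 0)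
    (hB : ∀ t, 0 ≤ t → HasDerivAt B (B' t) t)
    (hb : ∀ t, 0 ≤ t → t ≤ 1 → ‖c5 z‖ * ((n : ℝ) + t) ^ (-z.re - 4) ≤ B' t) :
    ‖T (n + 1) z - T n z‖ ≤ B 1 := by
  rw [T_succ_sub, norm_neg]
  have hn' : (0 : ℝ) < n := by exact_mod_cast hn
  have hd : ∀ t : ℝ, 0 ≤ t → HasDerivAt (fun t : ℝ => Q n z t - Q n z 0)
      (((t : ℂ) ^ 2 - 2 * (t : ℂ) ^ 3 + (t : ℂ) ^ 4) / 24 * (c5 z * ((n : ℂ) + t) ^ (-z - 4))) t := by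
    intro t ht
    refine (HasDerivAt.comp_ofReal (Q_deriv n z t ?_)).sub_const _
    left
    simp
    positivity
  have := image_norm_le_of_norm_deriv_right_le_deriv_boundary' (a := 0) (b := 1)
    (f := fun t : ℝ => Q n z t - Q n z 0) (B := B) (B' := B')
    (fun t ht => (hd t ht.1).continuousAt.continuousWithinAt)
    (fun t ht => (hd t ht.1).hasDerivWithinAt)
    (by simp [hB0]) 
    (fun t ht => (hB t ht.1).continuousAt.continuousWithinAt)
    (fun t ht => (hB t ht.1).hasDerivWithinAt)
    (fun t ht => ?_) (x := 1) (by simp)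
  · simpa using this
  · refine le_trans ?_ (hb t ht.1 ht.2.le)
    rw [norm_mul, norm_mul]
    have h1 : ‖((n : ℂ) + t) ^ (-z - 4)‖ = ((n : ℝ) + t) ^ (-z.re - 4) := by
      have := Complex.norm_cpow_eq_rpow_re_of_pos (x := (n : ℝ) + t)
        (by have := ht.1; positivity) (-z - 4)
      simpa using this
    rw [h1]
    have h2 : ‖((t : ℂ) ^ 2 - 2 * (t : ℂ) ^ 3 + (t : ℂ) ^ 4) / 24‖ ≤ 1 := by
      have : ((t : ℂ) ^ 2 - 2 * (t : ℂ) ^ 3 + (t : ℂ) ^ 4) / 24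
        = (((t * (1 - t)) ^ 2 / 24 : ℝ) : ℂ) := by push_cast; ring
      rw [this, Complex.norm_real, Real.norm_eq_abs, abs_of_nonneg (by positivity)]
      have := ht.1
      have := ht.2
      have h3 : t * (1 - t) ≤ 1 := by nlinarith
      have h4 : 0 ≤ t * (1 - t) := by nlinarith
      nlinarith
    refine mul_le_of_le_one_left ?_ h2
    have := ht.1
    positivity

lemma step1 (n : ℕ) (hn : 1 ≤ n) (z : ℂ) (hz : -3 < z.re) :
    ‖T (n + 1) z - T n z‖ ≤ ‖c5 z‖ * (n : ℝ) ^ (-z.re - 4) := by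
  have hn' : (0 : ℝ) < n := by exact_mod_cast hn
  have := step_bound n hn z (fun t => (‖c5 z‖ * (n : ℝ) ^ (-z.re - 4)) * t)
    (fun t => ‖c5 z‖ * (n : ℝ) ^ (-z.re - 4)) (by simp)
    (fun t _ => by simpa using (hasDerivAt_id' t).const_mul (‖c5 z‖ * (n : ℝ) ^ (-z.re - 4)))
    (fun t h0 h1 => by
      refine mul_le_mul_of_nonneg_left ?_ (norm_nonneg _)
      exact Real.rpow_le_rpow_of_nonpos hn' (by linarith) (by linarith))
  simpa using this

lemma step2 (n : ℕ) (hn : 1 ≤ n) (z : ℂ) (hz : -z.re - 3 ≠ 0) :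
    ‖T (n + 1) z - T n z‖ ≤ ‖c5 z‖ / (-z.re - 3) * ((n + 1 : ℕ) : ℝ) ^ (-z.re - 3)
      - ‖c5 z‖ / (-z.re - 3) * (n : ℝ) ^ (-z.re - 3) := by
  have hn' : (0 : ℝ) < n := by exact_mod_cast hn
  have := step_bound n hn z (fun t => ‖c5 z‖ / (-z.re - 3) * ((n : ℝ) + t) ^ (-z.re - 3)
      - ‖c5 z‖ / (-z.re - 3) * (n : ℝ) ^ (-z.re - 3))
    (fun t => ‖c5 z‖ * ((n : ℝ) + t) ^ (-z.re - 4)) (by simp)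
    (fun t h0 => by
      have h := ((((hasDerivAt_id' t).const_add (n : ℝ)).rpow_const (p := -z.re - 3)
        (Or.inl (by positivity))).const_mul (‖c5 z‖ / (-z.re - 3))).sub_const
        (‖c5 z‖ / (-z.re - 3) * (n : ℝ) ^ (-z.re - 3))
      refine h.congr_deriv ?_
      rw [show -z.re - 3 - 1 = -z.re - 4 by ring]
      field_simp)
    (fun t h0 h1 => le_rfl)
  simpa using this

lemma step3 (n : ℕ) (hn : 1 ≤ n) (z : ℂ) (hz : c5 z = 0) :
    T (n + 1) z - T n z = 0 := by
  have := step_bound n hn z (fun t => 0) (fun t => 0) rfl (fun t _ => hasDerivAt_const _ _)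
    (fun t _ _ => by simp [hz])
  simpa using this

lemma multi (z : ℂ) (hz : -z.re - 3 ≠ 0) (n m : ℕ) (hn : 1 ≤ n) (hm : n ≤ m) :
    ‖T m z - T n z‖ ≤ ‖c5 z‖ / (-z.re - 3) * (m : ℝ) ^ (-z.re - 3)
      - ‖c5 z‖ / (-z.re - 3) * (n : ℝ) ^ (-z.re - 3) := by
  induction m, hm using Nat.le_induction with
  | base => simp
  | succ m hm ih =>
    have h := step2 m (hn.trans hm) z hz
    have h3 := norm_add_le (T (m + 1) z - T m z) (T m z - T n z)
    rw [sub_add_sub_cancel] at h3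
    linarith

lemma tendsto_of_one_lt (z : ℂ) (hz : 1 < z.re) :
    Tendsto (fun n => T n z) atTop (𝓝 ((1 - z) * riemannZeta z)) := by
  have hw : ∀ w : ℂ, w.re < 0 → Tendsto (fun n : ℕ => (n : ℂ) ^ w) atTop (𝓝 0) := by
    intro w hw
    rw [tendsto_zero_iff_norm_tendsto_zero]
    have h := (tendsto_rpow_neg_atTop (y := -w.re) (by linarith)).comp
      (tendsto_natCast_atTop_atTop (R := ℝ))
    refine h.congr' ?_
    filter_upwards [eventually_gt_atTop 0] with n hn
    have := Complex.norm_natCast_cpow_of_pos hn w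
    simp [this]
  have hW : Tendsto (fun n => W n z) atTop (𝓝 0) := by
    have := (((hw (1 - z) (by simp; linarith)).add
      (((hw (-z) (by simp; linarith)).const_mul (1 - z)).div_const 2)).sub
      ((hw (-z - 1) (by simp; linarith)).const_mul (z * (1 - z) / 12)))
    simpa [W] using this
  have hs : HasSum (fun k : ℕ => ((k + 1 : ℕ) : ℂ) ^ (-z)) (riemannZeta z) := by
    rw [zeta_eq_tsum_one_div_nat_add_one_cpow hz]
    have h1 := (summable_nat_add_iff 1).2 (Complex.summable_one_div_nat_cpow.2 hz)
    have := h1.hasSum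
    simpa [cpow_neg] using this
  have := (hs.tendsto_sum_nat.const_mul (1 - z)).sub hW
  simpa [T] using this

lemma T_diff (n : ℕ) (hn : 1 ≤ n) : Differentiable ℂ (T n) := by
  have hc : ∀ k : ℕ, 1 ≤ k → ∀ f : ℂ → ℂ, Differentiable ℂ f →
      Differentiable ℂ (fun z => (k : ℂ) ^ (f z)) := by
    intro k hk f hf z
    exact (hf z).const_cpow (Or.inl (by exact_mod_cast (by omega : k ≠ 0)))
  have h1 := hc n hn (fun z => 1 - z) (by fun_prop)
  have h2 := hc n hn (fun z => -z) (by fun_prop)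
  have h3 := hc n hn (fun z => -z - 1) (by fun_prop)
  have h4 : Differentiable ℂ (fun z : ℂ => ∑ k ∈ Finset.range n, ((k + 1 : ℕ) : ℂ) ^ (-z)) :=
    Differentiable.fun_sum (fun k _ => hc (k + 1) (by omega) (fun z => -z) (by fun_prop))
  unfold T W
  fun_prop

lemma tendsto_zeta (z : ℂ) (hz : -3 < z.re) (hz1 : z ≠ 1) :
    Tendsto (fun n => T n z) atTop (𝓝 ((1 - z) * riemannZeta z)) := by
  obtain ⟨r, hr, hrz⟩ : ∃ r : ℝ, -3 < r ∧ r < min z.re 1 := exists_between (lt_min hz (by norm_num))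
  obtain ⟨hrz, hr1⟩ := lt_min_iff.1 hrz
  set R : ℝ := ‖z‖ + 3 with hR
  set U : Set ℂ := {w | r < w.re} ∩ Metric.ball 0 R with hU
  have hUo : IsOpen U := (isOpen_lt continuous_const continuous_re).inter Metric.isOpen_ball
  have hUc : IsPreconnected U :=
    ((convex_halfSpace_re_gt r).inter (convex_ball 0 R)).isPreconnected
  have hzU : z ∈ U := ⟨hrz, by simp [hR]⟩
  have h2U : (2 : ℂ) ∈ U := ⟨by simp; linarith, by
    simp [hR]; linarith [norm_nonneg z]⟩
  obtain ⟨M, hM⟩ : ∃ M, ∀ w ∈ Metric.closedBall (0 : ℂ) R, ‖c5 w‖ ≤ M :=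
    (isCompact_closedBall 0 R).exists_bound_of_continuousOn
      (by unfold c5; fun_prop)
  have hbd : ∀ (k : ℕ) (w : ℂ), w ∈ U →
      ‖T (k + 1 + 1) w - T (k + 1) w‖ ≤ M * ((k + 1 : ℕ) : ℝ) ^ (-r - 4) := by
    intro k w hw
    refine (step1 (k + 1) (by omega) w (hr.trans hw.1)).trans ?_
    have := hM w (Metric.ball_subset_closedBall hw.2)
    refine mul_le_mul this ?_ (by positivity) ((norm_nonneg _).trans this)
    refine Real.rpow_le_rpow_of_exponent_le (by simp) ?_
    have := hw.1
    simp only [Set.mem_ofPred_eq] at this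
    linarith
  have hsum : Summable (fun k : ℕ => M * ((k + 1 : ℕ) : ℝ) ^ (-r - 4)) :=
    ((summable_nat_add_iff 1).2 (Real.summable_nat_rpow.2 (by linarith))).mul_left M
  have hdiff : DifferentiableOn ℂ (fun w => T 1 w + ∑' k : ℕ, (T (k + 1 + 1) w - T (k + 1) w)) U :=
    (T_diff 1 le_rfl).differentiableOn.add
      (differentiableOn_tsum_of_summable_norm hsum
        (fun k => ((T_diff _ (by omega)).sub (T_diff _ (by omega))).differentiableOn) hUo hbd)
  have hlim : ∀ w ∈ U, Tendsto (fun n => T n w) atTop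
      (𝓝 (T 1 w + ∑' k : ℕ, (T (k + 1 + 1) w - T (k + 1) w))) := by
    intro w hw
    have h1 : Summable (fun k : ℕ => (T (k + 1 + 1) w - T (k + 1) w)) :=
      Summable.of_norm_bounded hsum (fun k => hbd k w hw)
    have h2 := h1.hasSum.tendsto_sum_nat.const_add (T 1 w)
    rw [← tendsto_add_atTop_iff_nat 1]
    refine h2.congr (fun n => ?_)
    rw [Finset.sum_range_sub (fun k => T (k + 1) w)]
    simp
  have heq : Set.EqOn (fun w => T 1 w + ∑' k : ℕ, (T (k + 1 + 1) w - T (k + 1) w))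
      (fun w => -riemannZeta₁ w) U := by
    refine (hdiff.analyticOnNhd hUo).eqOn_of_preconnected_of_eventuallyEq
      (differentiable_riemannZeta₁.neg.differentiableOn.analyticOnNhd hUo) hUc h2U ?_
    have ho : IsOpen {w : ℂ | 1 < w.re} := isOpen_lt continuous_const continuous_re
    filter_upwards [hUo.mem_nhds h2U, ho.mem_nhds (by simp : (2 : ℂ) ∈ {w : ℂ | 1 < w.re})]
      with w hw hw1
    have hne : w ≠ 1 := by rintro rfl; simp at hw1
    have := tendsto_nhds_unique (hlim w hw) (tendsto_of_one_lt w hw1)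
    rw [this, riemannZeta_eq_inv_sub_mul hne]
    have : w - 1 ≠ 0 := sub_ne_zero.2 hne
    field_simp
    ring
  have h := hlim z hzU
  have h' := heq hzU
  simp only at h'
  rw [h'] at h
  rw [riemannZeta_eq_inv_sub_mul hz1]
  have : z - 1 ≠ 0 := sub_ne_zero.2 hz1
  convert h using 2
  field_simp
  ring

lemma T_real (n : ℕ) (s : ℝ) (hs : 0 < s) :
    T n (-(s : ℂ)) = (((1 + s) * ((∑ k ∈ Finset.Icc 1 n, (k : ℝ) ^ s) -
        ((n : ℝ) ^ (1 + s) / (1 + s) + (n : ℝ) ^ s / 2 +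
          (s / 12) * (n : ℝ) ^ (s - 1))) : ℝ) : ℂ) := by
  have h1 : (1 + s : ℝ) * ((∑ k ∈ Finset.Icc 1 n, (k : ℝ) ^ s) -
        ((n : ℝ) ^ (1 + s) / (1 + s) + (n : ℝ) ^ s / 2 +
          (s / 12) * (n : ℝ) ^ (s - 1))) = (1 + s) * (∑ k ∈ Finset.range n, ((k + 1 : ℕ) : ℝ) ^ s) -
        ((n : ℝ) ^ (1 + s) + (1 + s) * (n : ℝ) ^ s / 2 +
          (s * (1 + s) / 12) * (n : ℝ) ^ (s - 1)) := by
    have : ∑ k ∈ Finset.Icc 1 n, (k : ℝ) ^ s = ∑ k ∈ Finset.range n, ((k + 1 : ℕ) : ℝ) ^ s := by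
      rw [Finset.range_eq_Ico, Finset.sum_Ico_add' (fun k : ℕ => (k : ℝ) ^ s) 0 n 1]
      rfl
    rw [this]
    field_simp
  have h2 : ∀ (k : ℕ) (r : ℝ), (((k : ℝ) ^ r : ℝ) : ℂ) = (k : ℂ) ^ (r : ℂ) := by
    intro k r
    simpa using Complex.ofReal_cpow (Nat.cast_nonneg k) r
  rw [h1, T, W]
  simp only [Complex.ofReal_sub, Complex.ofReal_add, Complex.ofReal_mul, Complex.ofReal_div,
    Complex.ofReal_sum, h2]
  simp only [Complex.ofReal_one, Complex.ofReal_ofNat, sub_neg_eq_add, neg_neg, Complex.ofReal_sub,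
    Complex.ofReal_add]
  ring

lemma main_bound (s : ℝ) (hs : 0 < s) : ∃ C : ℝ, ∀ n : ℕ, 1 ≤ n →
    ‖T n (-(s : ℂ)) - (1 + s) * riemannZeta (-(s : ℂ))‖ ≤ C * (n : ℝ) ^ (s - 3) := by
  set z : ℂ := -(s : ℂ) with hz
  have hre : -z.re - 3 = s - 3 := by simp [hz]
  have fin : 3 ≤ s → (∃ C, ∀ n : ℕ, 1 ≤ n → ‖T n z - T 1 z‖ ≤ C * (n : ℝ) ^ (s - 3)) →
      ∃ C : ℝ, ∀ n : ℕ, 1 ≤ n →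
        ‖T n z - (1 + s) * riemannZeta z‖ ≤ C * (n : ℝ) ^ (s - 3) := by
    rintro h3 ⟨C, hC⟩
    refine ⟨C + ‖T 1 z - (1 + s) * riemannZeta z‖, fun n hn => ?_⟩
    have h := norm_add_le (T n z - T 1 z) (T 1 z - (1 + s) * riemannZeta z)
    rw [sub_add_sub_cancel] at h
    have h1 : (1 : ℝ) ≤ (n : ℝ) ^ (s - 3) :=
      Real.one_le_rpow (by exact_mod_cast hn) (by linarith)
    nlinarith [hC n hn, norm_nonneg (T 1 z - (1 + s) * riemannZeta z)]
  rcases lt_trichotomy s 3 with h | h | h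
  · refine ⟨‖c5 z‖ / (3 - s), fun n hn => ?_⟩
    have hlim := tendsto_zeta z (by simp [hz]; linarith) (by
      intro h; have := congrArg Complex.re h; simp [hz] at this; linarith)
    rw [show (1 - z) = 1 + s by simp [hz]] at hlim
    rw [norm_sub_rev]
    refine le_of_tendsto ((hlim.sub_const (T n z)).norm) ?_
    filter_upwards [eventually_ge_atTop n] with m hm
    have := multi z (by rw [hre]; linarith) n m hn hm
    rw [hre] at this
    have e : ‖c5 z‖ / (s - 3) = - (‖c5 z‖ / (3 - s)) := by
      rw [← neg_sub 3 s, div_neg]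
    rw [e] at this
    have : 0 ≤ ‖c5 z‖ / (3 - s) * (m : ℝ) ^ (s - 3) := by
      have : 0 < 3 - s := by linarith
      positivity
    linarith
  · refine fin h.ge ⟨0, fun n hn => ?_⟩
    have h5 : c5 z = 0 := by simp [c5, hz, h]
    have : T n z = T 1 z := by
      induction n, hn using Nat.le_induction with
      | base => rfl
      | succ m hm ih => rw [← ih]; exact sub_eq_zero.1 (step3 m hm z h5)
    simp [this]
  · refine fin h.le ⟨‖c5 z‖ / (s - 3), fun n hn => ?_⟩
    have := multi z (by rw [hre]; linarith) 1 n le_rfl hn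
    rw [hre] at this
    have : 0 ≤ ‖c5 z‖ / (s - 3) * ((1 : ℕ) : ℝ) ^ (s - 3) := by
      have : 0 < s - 3 := by linarith
      positivity
    linarith

end SPE

/-- Asymptotic expansion of the sum of the `s`-th powers of the first `n`
positive integers, with error `O(n^{s-3})`. -/
theorem sum_powers_expansion (s : ℝ) (hs : 0 < s) :
    ∃ C > 0, ∀ n : ℕ, 1 ≤ n →
      |(∑ k ∈ Finset.Icc 1 n, (k : ℝ) ^ s) -
        (zetaR (-s) + (n : ℝ) ^ (1 + s) / (1 + s) + (n : ℝ) ^ s / 2 +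
          (s / 12) * (n : ℝ) ^ (s - 1))| ≤ C * (n : ℝ) ^ (s - 3) := by
  obtain ⟨C, hC⟩ := SPE.main_bound s hs
  refine ⟨|C| + 1, by positivity, fun n hn => ?_⟩
  have h := hC n hn
  rw [SPE.T_real n s hs] at h
  set A := (∑ k ∈ Finset.Icc 1 n, (k : ℝ) ^ s)
  set G := (n : ℝ) ^ (1 + s) / (1 + s) + (n : ℝ) ^ s / 2 + (s / 12) * (n : ℝ) ^ (s - 1) with hG
  have h1 := (Complex.abs_re_le_norm _).trans h
  have h2 : ((((1 + s) * (A - G) : ℝ) : ℂ) - (1 + s) * riemannZeta (-(s : ℂ))).re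
      = (1 + s) * (A - G - zetaR (-s)) := by
    simp [zetaR]
    ring
  rw [h2, abs_mul, abs_of_pos (by linarith : 0 < 1 + s)] at h1
  have h3 : A - (zetaR (-s) + (n : ℝ) ^ (1 + s) / (1 + s) + (n : ℝ) ^ s / 2 +
          (s / 12) * (n : ℝ) ^ (s - 1)) = A - G - zetaR (-s) := by rw [hG]; ring
  rw [h3]
  have h4 : 0 ≤ (n : ℝ) ^ (s - 3) := by positivity
  have h5 := abs_nonneg (A - G - zetaR (-s))
  have h6 := le_abs_self C
  nlinarith
end

section
/- Let 0 < α < 1 and x > 0. Then there exists a constant C > 0 such that for every positive integer N, with h = x/N, |h^{1+α} ∑_{k=1}^{N} k^α − (1/2) x^α h − (x^{1+α}/(1+α) + ζ(−α) h^{1+α} + (α x^{α−1}/12) h²)| ≤ C h⁴. Equivalently, the trapezoidal sum of z(t) = (x−t)^α on [0,x] with N subintervals equals J^α 1(x) + ζ(−α) h^{1+α} + (α x^{α−1}/12) h² + O(h⁴). -/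
lemma em_general (a : ℝ) (g f f1 f2 f3 f4 : ℝ → ℂ) (M : ℝ)
    (hg : ∀ t ∈ Set.Icc a (a+1), HasDerivAt g (f t) t)
    (hf : ∀ t ∈ Set.Icc a (a+1), HasDerivAt f (f1 t) t)
    (hf1 : ∀ t ∈ Set.Icc a (a+1), HasDerivAt f1 (f2 t) t)
    (hf2 : ∀ t ∈ Set.Icc a (a+1), HasDerivAt f2 (f3 t) t)
    (hf3 : ∀ t ∈ Set.Icc a (a+1), HasDerivAt f3 (f4 t) t)
    (hM : ∀ t ∈ Set.Icc a (a+1), ‖f4 t‖ ≤ M) :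
    ‖f (a+1) - ((g (a+1) + f (a+1) / 2 + f1 (a+1) / 12) - (g a + f a / 2 + f1 a / 12))‖ ≤ M := by
  let p : ℝ → ℂ := fun t => ((t - a : ℝ) : ℂ)
  have hp : ∀ t, HasDerivAt p 1 t := by
    intro t
    exact (((hasDerivAt_id t).sub_const a).ofReal_comp).congr_deriv (by simp)
  let Φ : ℝ → ℂ := fun t => (p t)^2 * (1 - p t)^2 / 24 * f3 t
    - (p t * (1 - p t) * (1 - 2 * p t)) / 12 * f2 t
    + (1 - 6 * p t + 6 * (p t)^2) / 12 * f1 t - (p t - 1/2) * f t + g t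
  have hΦ : ∀ t ∈ Set.Icc a (a+1),
      HasDerivWithinAt Φ ((p t)^2 * (1 - p t)^2 / 24 * f4 t) (Set.Icc a (a+1)) t := by
    intro t ht
    have h1 := ((((hp t).pow 2).mul (((hp t).const_sub 1).pow 2)).div_const 24).mul (hf3 t ht)
    have h2 := ((((hp t).mul ((hp t).const_sub 1)).mul
      (((hp t).const_mul 2).const_sub 1)).div_const 12).mul (hf2 t ht)
    have h3 := (((((hp t).const_mul 6).const_sub 1).add
      (((hp t).pow 2).const_mul 6)).div_const 12).mul (hf1 t ht)
    have h4 := ((hp t).sub_const (1/2)).mul (hf t ht)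
    have h5 := (((h1.sub h2).add h3).sub h4).add (hg t ht)
    refine (h5.congr_deriv ?_).hasDerivWithinAt
    simp only [Pi.mul_apply, Pi.pow_apply, Pi.add_apply]
    push_cast
    ring
  have hb : ∀ t ∈ Set.Ico a (a+1), ‖(p t)^2 * (1 - p t)^2 / 24 * f4 t‖ ≤ M := by
    intro t ht
    have hm := hM t ⟨ht.1, ht.2.le⟩
    have e : (p t)^2 * (1 - p t)^2 / 24 = (((t-a)^2 * (1-(t-a))^2/24 : ℝ) : ℂ) := by
      simp [p]
    rw [e, norm_mul, Complex.norm_real, Real.norm_of_nonneg (by positivity)]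
    have h0 : 0 ≤ t - a := by linarith [ht.1]
    have h1 : t - a ≤ 1 := by linarith [ht.2]
    have h2 : (t-a)^2 ≤ 1 := by nlinarith
    have h3 : (1-(t-a))^2 ≤ 1 := by nlinarith
    have h4 : (t-a)^2 * (1-(t-a))^2 ≤ 1 := mul_le_one₀ h2 (by positivity) h3
    nlinarith [norm_nonneg (f4 t)]
  have := norm_image_sub_le_of_norm_deriv_le_segment' hΦ hb (a+1) ⟨by linarith, le_rfl⟩
  rw [show a + 1 - a = 1 by ring, mul_one, norm_sub_rev] at this
  have pa : p a = 0 := by simp [p]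
  have pb : p (a + 1) = 1 := by simp [p]
  refine le_of_eq_of_le (congrArg norm ?_) this
  simp only [Φ, pa, pb]
  ring

lemma cpow_deriv (r : ℂ) (t : ℝ) (ht : 0 < t) (c : ℂ) :
    HasDerivAt (fun y : ℝ => c * (y : ℂ) ^ r) (c * r * (t : ℂ) ^ (r - 1)) t := by
  have h : HasDerivAt (fun y : ℂ => y ^ r) (r * (t : ℂ) ^ (r - 1)) (t : ℂ) := by
    simpa using (hasDerivAt_id (t : ℂ)).cpow_const (c := r) (by left; simpa using ht)
  simpa [mul_assoc] using h.comp_ofReal.const_mul c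

noncomputable def emF (s : ℂ) (t : ℝ) : ℂ :=
  (1 - s)⁻¹ * (t : ℂ) ^ (1 - s) + (t : ℂ) ^ (-s) / 2 + (-s * (t : ℂ) ^ (-s - 1)) / 12

noncomputable def emA (n : ℕ) (s : ℂ) : ℂ :=
  (((n + 1 : ℝ) : ℂ)) ^ (-s) - (emF s (n + 1) - emF s n)

lemma emA_bound (n : ℕ) (hn : 0 < n) (s : ℂ) (hs : s ≠ 1) (hs' : -4 ≤ s.re) :
    ‖emA n s‖ ≤ ‖s * (s+1) * (s+2) * (s+3)‖ * (n : ℝ) ^ (-s.re - 4) := by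
  have hn' : (0:ℝ) < n := by exact_mod_cast hn
  have hpos : ∀ t ∈ Set.Icc (n:ℝ) (n+1), 0 < t := fun t ht => hn'.trans_le ht.1
  have hs1 : (1 - s) ≠ 0 := sub_ne_zero.mpr hs.symm
  refine em_general (n:ℝ) (fun t => (1 - s)⁻¹ * (t : ℂ) ^ (1 - s)) (fun t => (t : ℂ) ^ (-s))
    (fun t => -s * (t : ℂ) ^ (-s - 1)) (fun t => -s * (-s-1) * (t : ℂ) ^ (-s - 1 - 1))
    (fun t => -s * (-s-1) * (-s-1-1) * (t : ℂ) ^ (-s - 1 - 1 - 1))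
    (fun t => -s * (-s-1) * (-s-1-1) * (-s-1-1-1) * (t : ℂ) ^ (-s - 1 - 1 - 1 - 1)) _
    ?_ ?_ ?_ ?_ ?_ ?_
  · intro t ht
    refine (cpow_deriv _ t (hpos t ht) _).congr_deriv ?_
    rw [inv_mul_cancel₀ hs1, one_mul]; congr 1; ring
  · intro t ht
    simpa using (cpow_deriv (-s) t (hpos t ht) 1)
  · intro t ht
    exact (cpow_deriv _ t (hpos t ht) _)
  · intro t ht
    exact (cpow_deriv _ t (hpos t ht) _)
  · intro t ht
    exact (cpow_deriv _ t (hpos t ht) _)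
  · intro t ht
    rw [norm_mul, Complex.norm_cpow_eq_rpow_re_of_pos (hpos t ht)]
    rw [show -s * (-s-1) * (-s-1-1) * (-s-1-1-1) = s * (s+1) * (s+2) * (s+3) by ring]
    rw [show (-s-1-1-1-1).re = -s.re - 4 by simp; ring]
    gcongr ?_ * ?_
    exact Real.rpow_le_rpow_of_nonpos hn' ht.1 (by linarith)

noncomputable def emB (s : ℂ) (N : ℕ) : ℂ :=
  ∑ k ∈ Finset.range N, (((k + 1 : ℝ) : ℂ)) ^ (-s) - emF s N

noncomputable def emG (s : ℂ) : ℂ := emB s 1 + ∑' n : ℕ, emA (n + 1) s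

lemma emB_succ (s : ℂ) (N : ℕ) : emB s (N + 1) = emB s N + emA N s := by
  simp only [emB, emA, Finset.sum_range_succ]
  push_cast
  ring

lemma emB_eq (s : ℂ) (N : ℕ) :
    emB s (N + 1) = emB s 1 + ∑ n ∈ Finset.range N, emA (n + 1) s := by
  induction N with
  | zero => simp
  | succ N ih => rw [emB_succ, ih, Finset.sum_range_succ]; ring

lemma emA_bound' (n : ℕ) (s : ℂ) (hs : s ≠ 1) (hs' : -1 < s.re) (R : ℝ) (hR : ‖s‖ ≤ R) :
    ‖emA (n + 1) s‖ ≤ (R * (R+1) * (R+2) * (R+3)) * (((n + 1 : ℕ) : ℝ) ^ 2)⁻¹ := by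
  refine (emA_bound (n+1) (Nat.succ_pos n) s hs (by linarith)).trans ?_
  have hR0 : 0 ≤ R := (norm_nonneg s).trans hR
  have h1 : ‖s + 1‖ ≤ R + 1 := (norm_add_le _ _).trans (by simpa using hR)
  have h2 : ‖s + 2‖ ≤ R + 2 := (norm_add_le _ _).trans (by simpa using hR)
  have h3 : ‖s + 3‖ ≤ R + 3 := (norm_add_le _ _).trans (by simpa using hR)
  have hn : (1 : ℝ) ≤ ((n + 1 : ℕ) : ℝ) := by simp
  have h4 : ((n + 1 : ℕ) : ℝ) ^ (-s.re - 4) ≤ (((n + 1 : ℕ) : ℝ) ^ 2)⁻¹ := by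
    rw [← Real.rpow_natCast, ← Real.rpow_neg (by positivity)]
    exact Real.rpow_le_rpow_of_exponent_le hn (by push_cast; linarith)
  rw [norm_mul, norm_mul, norm_mul]
  gcongr

lemma summable_inv_sq_shift (K : ℝ) : Summable fun n : ℕ => K * (((n + 1 : ℕ) : ℝ) ^ 2)⁻¹ := by
  refine Summable.mul_left _ ?_
  exact (summable_nat_add_iff 1 (f := fun n : ℕ => ((n : ℝ) ^ 2)⁻¹)).mpr
    (Real.summable_nat_pow_inv.mpr one_lt_two)

lemma emB_tendsto (s : ℂ) (hs : s ≠ 1) (hs' : -1 < s.re) :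
    Filter.Tendsto (fun N : ℕ => emB s (N + 1)) Filter.atTop (nhds (emG s)) := by
  have : Summable fun n : ℕ => emA (n + 1) s :=
    Summable.of_norm_bounded (summable_inv_sq_shift _)
      (fun n => emA_bound' n s hs hs' _ le_rfl)
  refine Filter.Tendsto.congr (fun N => (emB_eq s N).symm) ?_
  exact this.hasSum.tendsto_sum_nat.const_add _

lemma emF_diff (t : ℝ) (ht : 0 < t) (s : ℂ) (hs : s ≠ 1) :
    DifferentiableAt ℂ (fun s => emF s t) s := by
  have ht' : (t : ℂ) ≠ 0 := by exact_mod_cast ht.ne'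
  have hs1 : (1 - s) ≠ 0 := sub_ne_zero.mpr hs.symm
  unfold emF
  have h1 : DifferentiableAt ℂ (fun s : ℂ => (1 - s)⁻¹) s := by fun_prop (disch := assumption)
  have h2 : DifferentiableAt ℂ (fun s : ℂ => (t : ℂ) ^ (1 - s)) s :=
    DifferentiableAt.const_cpow (by fun_prop) (Or.inl ht')
  have h3 : DifferentiableAt ℂ (fun s : ℂ => (t : ℂ) ^ (-s)) s :=
    DifferentiableAt.const_cpow (by fun_prop) (Or.inl ht')
  have h4 : DifferentiableAt ℂ (fun s : ℂ => (t : ℂ) ^ (-s - 1)) s :=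
    DifferentiableAt.const_cpow (by fun_prop) (Or.inl ht')
  fun_prop

lemma cpow_neg_diff (t : ℝ) (ht : 0 < t) (s : ℂ) :
    DifferentiableAt ℂ (fun s : ℂ => (t : ℂ) ^ (-s)) s :=
  DifferentiableAt.const_cpow (by fun_prop) (Or.inl (by exact_mod_cast ht.ne'))

lemma emG_diff (s : ℂ) (hs : s ≠ 1) (hs' : -1 < s.re) : DifferentiableAt ℂ emG s := by
  have hB : DifferentiableAt ℂ (fun s => emB s 1) s := by
    unfold emB
    refine DifferentiableAt.sub ?_ (by simpa using emF_diff 1 one_pos s hs)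
    simp only [Finset.range_one, Finset.sum_singleton]
    exact cpow_neg_diff _ (by positivity) s
  refine hB.add ?_
  let U : Set ℂ := {z | z ≠ 1} ∩ {z | -1 < z.re} ∩ {z | ‖z‖ < ‖s‖ + 1}
  have hU : IsOpen U := by
    refine (isOpen_ne.inter (isOpen_lt continuous_const Complex.continuous_re)).inter
      (isOpen_lt continuous_norm continuous_const)
  have hsU : s ∈ U := ⟨⟨hs, hs'⟩, by simp⟩
  have := Complex.differentiableOn_tsum_of_summable_norm (F := fun n s => emA (n + 1) s) (U := U)
    (summable_inv_sq_shift ((‖s‖+1) * ((‖s‖+1)+1) * ((‖s‖+1)+2) * ((‖s‖+1)+3))) ?_ hU ?_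
  · exact this.differentiableAt (hU.mem_nhds hsU)
  · intro n z hz
    refine DifferentiableAt.differentiableWithinAt ?_
    unfold emA
    refine (cpow_neg_diff _ (by positivity) z).sub
      ((emF_diff _ (by positivity) z hz.1.1).sub (emF_diff _ (by positivity) z hz.1.1))
  · intro n z hz
    exact emA_bound' n z hz.1.1 hz.1.2 _ hz.2.le

lemma cpow_tendsto_zero (r : ℂ) (hr : r.re < 0) :
    Filter.Tendsto (fun N : ℕ => (((N + 1 : ℕ) : ℝ) : ℂ) ^ r) Filter.atTop (nhds 0) := by
  rw [tendsto_zero_iff_norm_tendsto_zero]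
  have h : ∀ N : ℕ, ‖(((N + 1 : ℕ) : ℝ) : ℂ) ^ r‖ = ((N + 1 : ℕ) : ℝ) ^ (-(-r.re)) := by
    intro N
    rw [Complex.norm_cpow_eq_rpow_re_of_pos (by positivity), neg_neg]
  simp only [h]
  exact (tendsto_rpow_neg_atTop (by linarith)).comp
    (tendsto_natCast_atTop_atTop.comp (Filter.tendsto_add_atTop_nat 1))

lemma emG_eq_zeta_of_one_lt (s : ℂ) (hs : 1 < s.re) : emG s = riemannZeta s := by
  have hs1 : s ≠ 1 := by rintro rfl; simp at hs
  refine tendsto_nhds_unique (emB_tendsto s hs1 (by linarith)) ?_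
  have hsum : Summable fun n : ℕ => (((n + 1 : ℝ) : ℂ)) ^ (-s) := by
    have := (summable_nat_add_iff (G := ℂ) 1).mpr (Complex.summable_one_div_nat_cpow.mpr hs)
    refine this.congr fun n => ?_
    rw [Complex.cpow_neg, one_div]; push_cast; rfl
  have h1 : Filter.Tendsto (fun N : ℕ => ∑ k ∈ Finset.range (N+1), (((k + 1 : ℝ) : ℂ)) ^ (-s))
      Filter.atTop (nhds (riemannZeta s)) := by
    rw [zeta_eq_tsum_one_div_nat_add_one_cpow hs]
    have := hsum.hasSum.tendsto_sum_nat.comp (Filter.tendsto_add_atTop_nat 1)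
    have e : ∑' n : ℕ, 1 / (n + 1 : ℂ) ^ s = ∑' n : ℕ, (((n + 1 : ℝ) : ℂ)) ^ (-s) := by
      refine tsum_congr fun n => ?_
      rw [Complex.cpow_neg, one_div]; push_cast; rfl
    rw [e]
    exact this
  have h2 := cpow_tendsto_zero (1 - s) (by simp; linarith)
  have h3 := cpow_tendsto_zero (-s) (by simp; linarith)
  have h4 := cpow_tendsto_zero (-s - 1) (by simp; linarith)
  have h5 := h1.sub (((h2.const_mul (1-s)⁻¹).add (h3.div_const 2)).add
    ((h4.const_mul (-s)).div_const 12))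
  simpa [emB, emF] using h5

lemma emG_eq_zeta (a : ℝ) (h1 : -1 < a) (h2 : a < 1) : emG a = riemannZeta a := by
  let A : Set ℂ := {z | -1 < z.re} ∩ {z | 0 < z.im}
  let B : Set ℂ := {z | 1 < z.re}
  let D : Set ℂ := {z | -1 < z.re} ∩ {z | z.re < 1}
  let U : Set ℂ := (B ∪ A) ∪ D
  have hBc : IsPreconnected B := (convex_halfSpace_re_gt 1).isPreconnected
  have hAc : IsPreconnected A :=
    ((convex_halfSpace_re_gt _).inter (convex_halfSpace_im_gt 0)).isPreconnected
  have hDc : IsPreconnected D :=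
    ((convex_halfSpace_re_gt _).inter (convex_halfSpace_re_lt 1)).isPreconnected
  have hUc : IsPreconnected U := by
    refine IsPreconnected.union Complex.I (Or.inr ?_) ?_
      (IsPreconnected.union (2 + Complex.I) ?_ ?_ hBc hAc) hDc
    · simp [A]
    · simp [D]
    · simp [B]
    · simp [A]; norm_num
  have hBo : IsOpen B := isOpen_lt continuous_const Complex.continuous_re
  have hUo : IsOpen U :=
    (hBo.union
      ((isOpen_lt continuous_const Complex.continuous_re).inter
        (isOpen_lt continuous_const Complex.continuous_im))).union
      ((isOpen_lt continuous_const Complex.continuous_re).inter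
        (isOpen_lt Complex.continuous_re continuous_const))
  have hU1 : ∀ z ∈ U, z ≠ 1 ∧ -1 < z.re := by
    rintro z ((hz | hz) | hz)
    · have hz : 1 < z.re := hz
      exact ⟨by rintro rfl; simp at hz, by linarith⟩
    · have h0 : 0 < z.im := hz.2
      exact ⟨by rintro rfl; simp at h0, hz.1⟩
    · have h0 : z.re < 1 := hz.2
      exact ⟨by rintro rfl; simp at h0, hz.1⟩
  have hGa : AnalyticOnNhd ℂ emG U := DifferentiableOn.analyticOnNhd
    (fun z hz => (emG_diff z (hU1 z hz).1 (hU1 z hz).2).differentiableWithinAt) hUo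
  have hZa : AnalyticOnNhd ℂ riemannZeta U := DifferentiableOn.analyticOnNhd
    (fun z hz => (differentiableAt_riemannZeta (hU1 z hz).1).differentiableWithinAt) hUo
  have h2B : (2 : ℂ) ∈ B := by simp [B]
  refine hGa.eqOn_of_preconnected_of_eventuallyEq hZa hUc (z₀ := 2) (Or.inl (Or.inl h2B)) ?_
    (Or.inr ⟨by simpa using h1, by simpa using h2⟩)
  filter_upwards [hBo.mem_nhds h2B] with z hz
  exact emG_eq_zeta_of_one_lt z hz

lemma emB_sub_bound (α : ℝ) (hα0 : 0 < α) (hα1 : α < 1) (N : ℕ) (hN : 0 < N) (j : ℕ) :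
    ‖emB (-α : ℝ) (N + j) - emB (-α : ℝ) N‖ ≤
      2 * 24 * (N : ℝ) ^ (α - 2) * (1 / (N : ℝ) - 1 / ((N + j : ℕ) : ℝ)) := by
  induction j with
  | zero => simp
  | succ j ih =>
    have hNR : (0 : ℝ) < N := by exact_mod_cast hN
    set k := N + j with hk
    have hkN : (N : ℝ) ≤ k := by rw [hk]; push_cast; linarith [(Nat.cast_nonneg j : (0:ℝ) ≤ j)]
    have hk1 : (1 : ℝ) ≤ k := by
      have : 1 ≤ k := by omega
      exact_mod_cast this
    have hb := emA_bound k (by omega) ((-α : ℝ) : ℂ) (by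
      intro h
      have := congrArg Complex.re h
      simp at this
      linarith) (by simp; linarith)
    have hs : ‖((-α : ℝ) : ℂ) * (((-α : ℝ) : ℂ) + 1) * (((-α : ℝ) : ℂ) + 2)
        * (((-α : ℝ) : ℂ) + 3)‖ ≤ 24 := by
      have n0 : ‖((-α : ℝ) : ℂ)‖ ≤ 1 := by
        rw [Complex.norm_real, Real.norm_eq_abs, abs_neg, abs_of_pos hα0]; exact hα1.le
      have n1 : ‖((-α : ℝ) : ℂ) + 1‖ ≤ 2 := (norm_add_le _ _).trans (by simp at n0 ⊢; linarith)
      have n2 : ‖((-α : ℝ) : ℂ) + 2‖ ≤ 3 := (norm_add_le _ _).trans (by simp at n0 ⊢; linarith)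
      have n3 : ‖((-α : ℝ) : ℂ) + 3‖ ≤ 4 := (norm_add_le _ _).trans (by simp at n0 ⊢; linarith)
      rw [norm_mul, norm_mul, norm_mul]
      calc _ ≤ (1 : ℝ) * 2 * 3 * 4 := by gcongr
        _ = 24 := by norm_num
    have hp : (k : ℝ) ^ (-((-α : ℝ) : ℂ).re - 4) ≤
        (N : ℝ) ^ (α - 2) * (2 * (1 / (k : ℝ) - 1 / ((k + 1 : ℕ) : ℝ))) := by
      rw [Complex.ofReal_re, show -(-α) - 4 = (α - 2) + (-2 : ℝ) by ring,
        Real.rpow_add (by linarith)]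
      gcongr ?_ * ?_
      · exact Real.rpow_le_rpow_of_nonpos hNR hkN (by linarith)
      · rw [Real.rpow_neg (by linarith), show (k : ℝ) ^ (2 : ℝ) = (k : ℝ) ^ 2 by norm_cast]
        push_cast
        rw [inv_eq_one_div, div_sub_div _ _ (by linarith) (by linarith), mul_div_assoc',
          div_le_div_iff₀ (by positivity) (by positivity)]
        nlinarith
    have e : N + (j + 1) = k + 1 := by omega
    rw [e, emB_succ]
    calc ‖emB (-α : ℝ) k + emA k (-α : ℝ) - emB (-α : ℝ) N‖
        = ‖(emB (-α : ℝ) k - emB (-α : ℝ) N) + emA k (-α : ℝ)‖ := by congr 1; ring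
      _ ≤ _ := norm_add_le _ _
      _ ≤ 2 * 24 * (N : ℝ) ^ (α - 2) * (1 / (N : ℝ) - 1 / (k : ℝ)) +
          24 * ((N : ℝ) ^ (α - 2) * (2 * (1 / (k : ℝ) - 1 / ((k + 1 : ℕ) : ℝ)))) := by
        refine add_le_add ih (hb.trans ?_)
        gcongr
      _ = _ := by ring

lemma emB_zeta_bound (α : ℝ) (hα0 : 0 < α) (hα1 : α < 1) (N : ℕ) (hN : 0 < N) :
    ‖emB (-α : ℝ) N - riemannZeta (-α : ℝ)‖ ≤ 48 * (N : ℝ) ^ (α - 3) := by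
  have hNR : (0 : ℝ) < N := by exact_mod_cast hN
  have hne : ((-α : ℝ) : ℂ) ≠ 1 := by
    intro h
    have := congrArg Complex.re h
    simp at this
    linarith
  have ht := emB_tendsto ((-α : ℝ) : ℂ) hne (by simp; linarith)
  rw [emG_eq_zeta (-α) (by linarith) (by linarith)] at ht
  have ht2 : Filter.Tendsto (fun j : ℕ => emB (-α : ℝ) (N + j)) Filter.atTop
      (nhds (riemannZeta (-α : ℝ))) := by
    have h0 := (Filter.tendsto_add_atTop_iff_nat (f := fun N => emB (-α : ℝ) N) 1).mp ht
    have := (Filter.tendsto_add_atTop_iff_nat N).mpr h0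
    simpa [add_comm] using this
  rw [norm_sub_rev]
  refine le_of_tendsto (ht2.sub_const _).norm (Filter.Eventually.of_forall fun j => ?_)
  refine (emB_sub_bound α hα0 hα1 N hN j).trans ?_
  rw [show α - 3 = (α - 2) + (-1 : ℝ) by ring, Real.rpow_add hNR, Real.rpow_neg_one]
  have : (0:ℝ) ≤ 1 / ((N + j : ℕ) : ℝ) := by positivity
  have h3 : 0 ≤ (N : ℝ) ^ (α - 2) := by positivity
  rw [← one_div]
  nlinarith

lemma emB_re (α : ℝ) (N : ℕ) :
    (emB (-α : ℝ) N).re = ∑ k ∈ Finset.Icc 1 N, (k : ℝ) ^ α -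
      ((1 + α)⁻¹ * (N : ℝ) ^ (1 + α) + (N : ℝ) ^ α / 2 + α * (N : ℝ) ^ (α - 1) / 12) := by
  have : emB (-α : ℝ) N = ((∑ k ∈ Finset.Icc 1 N, (k : ℝ) ^ α -
      ((1 + α)⁻¹ * (N : ℝ) ^ (1 + α) + (N : ℝ) ^ α / 2 + α * (N : ℝ) ^ (α - 1) / 12) : ℝ) : ℂ) := by
    have hs : ∑ k ∈ Finset.Icc 1 N, (k : ℝ) ^ α = ∑ k ∈ Finset.range N, ((k : ℝ) + 1) ^ α := by
      have := Finset.sum_Ico_add' (fun k : ℕ => (k : ℝ) ^ α) 0 N 1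
      rw [Finset.range_eq_Ico]
      push_cast at this
      rw [this]
      rfl
    have hN0 : (0:ℝ) ≤ N := Nat.cast_nonneg N
    rw [hs]
    unfold emB emF
    rw [Complex.ofReal_sub, Complex.ofReal_sum]
    congr 1
    · refine Finset.sum_congr rfl fun k _ => ?_
      rw [Complex.ofReal_cpow (by positivity)]
      congr 1
      simp
    · rw [Complex.ofReal_add, Complex.ofReal_add, Complex.ofReal_div, Complex.ofReal_div,
        Complex.ofReal_mul, Complex.ofReal_mul, Complex.ofReal_cpow hN0, Complex.ofReal_cpow hN0,
        Complex.ofReal_cpow hN0]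
      simp
  rw [this, Complex.ofReal_re]

/-- Fourth-order expansion of the trapezoidal approximation for the fractional
integral `J^α 1(x) = ∫₀ˣ (x-t)^α dt = x^{1+α}/(1+α)`:
`T_h[(x-t)^α] = J^α 1(x) + ζ(-α) h^{1+α} + (α x^{α-1}/12) h² + O(h⁴)`. -/
theorem trapezoid_expansion_pow_alpha (α x : ℝ) (hα0 : 0 < α) (hα1 : α < 1)
    (hx : 0 < x) :
    ∃ C > 0, ∀ N : ℕ, 0 < N → ∀ h : ℝ, h = x / N →
      |h ^ (1 + α) * (∑ k ∈ Finset.Icc 1 N, (k : ℝ) ^ α) - (1 / 2) * x ^ α * h -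
        (x ^ (1 + α) / (1 + α) + zetaR (-α) * h ^ (1 + α) +
          (α * x ^ (α - 1) / 12) * h ^ 2)| ≤ C * h ^ 4 := by
  have key : ∀ N : ℕ, 0 < N → ∀ h : ℝ, h = x / N → ∀ a b : ℝ, ∀ m : ℕ, a + m = b →
      h ^ b * (N : ℝ) ^ a = x ^ a * h ^ m := by
    intro N hN h hh a b m hab
    have hNR : (0 : ℝ) < N := by exact_mod_cast hN
    have hpos : 0 < h := by rw [hh]; positivity
    have hxe : x = h * N := by rw [hh]; field_simp
    rw [hxe, Real.mul_rpow hpos.le hNR.le, ← hab, Real.rpow_add hpos, Real.rpow_natCast]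
    ring
  refine ⟨48 * x ^ (α - 3), by positivity, ?_⟩
  intro N hN h hh
  have hNR : (0 : ℝ) < N := by exact_mod_cast hN
  have hpos : 0 < h := by rw [hh]; positivity
  have k0 := key N hN h hh (1 + α) (1 + α) 0 (by simp)
  have k1 := key N hN h hh α (1 + α) 1 (by push_cast; ring)
  have k2 := key N hN h hh (α - 1) (1 + α) 2 (by push_cast; ring)
  have k4 := key N hN h hh (α - 3) (1 + α) 4 (by push_cast; ring)
  have hb := (Complex.abs_re_le_norm _).trans (emB_zeta_bound α hα0 hα1 N hN)
  rw [Complex.sub_re, emB_re α N] at hb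
  have hz : zetaR (-α) = (riemannZeta ((-α : ℝ) : ℂ)).re := rfl
  rw [← hz] at hb
  have hp : 0 < h ^ (1 + α) := by positivity
  have hm := mul_le_mul_of_nonneg_left hb hp.le
  rw [← abs_of_pos hp, ← abs_mul, abs_of_pos hp] at hm
  refine le_of_eq_of_le (congrArg abs ?_) (hm.trans_eq ?_)
  · simp only [pow_zero, pow_one, mul_one] at k0 k1
    linear_combination (1 + α)⁻¹ * k0 + k1 / 2 + α / 12 * k2
  · linear_combination 48 * k4
end

section
/- Let 0 < α < 1 and x > 0. Then there exists a constant C > 0 such that for every positive integer N, with h = x/N, |h^{2+α} ∑_{k=1}^{N} k^{1+α} − (x^{1+α}/2) h − (x^{2+α}/(2+α) + ((1+α) x^{α}/12) h² + ζ(−1−α) h^{2+α})| ≤ C h⁴. Equivalently, the trapezoidal sum of z(t) = (x−t)^{1+α} on [0,x] with N subintervals equals J^α y(x) + ((1+α) x^{α}/12) h² + ζ(−1−α) h^{2+α} + O(h⁴), where y(t) = (x−t)^α. -/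
noncomputable def EM (s : ℂ) (n : ℕ) : ℂ :=
  ∑ k ∈ Finset.Icc 1 n, (k : ℂ) ^ (-s) - (n : ℂ) ^ (-s) / 2 - (n : ℂ) ^ (1 - s) / (1 - s)
    + s * (n : ℂ) ^ (-s - 1) / 12

lemma pow_der (n : ℕ) (hn : 0 < n) (c : ℂ) (t : ℝ) (ht : 0 ≤ t) :
    HasDerivAt (fun t : ℝ => ((n : ℂ) + (t : ℂ)) ^ c) (c * ((n : ℂ) + (t : ℂ)) ^ (c - 1)) t := by
  have hn' : (0 : ℝ) < n := by exact_mod_cast hn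
  have h1 : HasDerivAt (fun z : ℂ => (n : ℂ) + z) 1 (t : ℂ) := (hasDerivAt_id _).const_add _
  have h2 := h1.cpow_const (c := c) (by
    left; simp; linarith)
  simpa using h2.comp_ofReal

lemma EM_step (s : ℂ) (hs : s ≠ 1) (hs4 : -4 ≤ s.re) (n : ℕ) (hn : 0 < n) :
    ‖EM s (n + 1) - EM s n‖ ≤ ‖s * (s + 1) * (s + 2) * (s + 3)‖ * (n : ℝ) ^ (-s.re - 4) := by
  have hn' : (0 : ℝ) < n := by exact_mod_cast hn
  have hs1 : (1 : ℂ) - s ≠ 0 := sub_ne_zero.mpr hs.symm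
  let q0 : ℝ → ℂ := fun t => ((t : ℂ) ^ 2 - 2 * (t : ℂ) ^ 3 + (t : ℂ) ^ 4) / 24
  let q1 : ℝ → ℂ := fun t => (2 * (t : ℂ) - 6 * (t : ℂ) ^ 2 + 4 * (t : ℂ) ^ 3) / 24
  let q2 : ℝ → ℂ := fun t => (2 - 12 * (t : ℂ) + 12 * (t : ℂ) ^ 2) / 24
  let q3 : ℝ → ℂ := fun t => (-12 + 24 * (t : ℂ)) / 24
  let P : ℂ → ℝ → ℂ := fun c t => ((n : ℂ) + (t : ℂ)) ^ c
  have hid : ∀ t : ℝ, HasDerivAt (fun t : ℝ => (t : ℂ)) 1 t := fun t =>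
    (hasDerivAt_id (t : ℂ)).comp_ofReal
  have dq0 : ∀ t, HasDerivAt q0 (q1 t) t := fun t => by
    have := ((((hid t).pow 2).sub (((hid t).pow 3).const_mul 2)).add ((hid t).pow 4)).div_const 24
    refine this.congr_deriv ?_
    simp only [q1]; push_cast; ring
  have dq1 : ∀ t, HasDerivAt q1 (q2 t) t := fun t => by
    have := ((((hid t).const_mul 2).sub (((hid t).pow 2).const_mul 6)).add
      (((hid t).pow 3).const_mul 4)).div_const 24
    refine this.congr_deriv ?_
    simp only [q2]; push_cast; ring
  have dq2 : ∀ t, HasDerivAt q2 (q3 t) t := fun t => by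
    have := ((((hid t).const_mul 12).const_sub 2).add (((hid t).pow 2).const_mul 12)).div_const 24
    refine this.congr_deriv ?_
    simp only [q3]; push_cast; ring
  have dq3 : ∀ t, HasDerivAt q3 1 t := fun t => by
    have := (((hid t).const_mul 24).const_add (-12)).div_const 24
    refine this.congr_deriv ?_
    norm_num
  let H : ℝ → ℂ := fun t => q0 t * (-(s * (s + 1) * (s + 2)) * P (-s - 3) t)
    - q1 t * (s * (s + 1) * P (-s - 2) t) + q2 t * (-s * P (-s - 1) t) - q3 t * P (-s) t
    + P (1 - s) t / (1 - s)
  have dH : ∀ t ∈ Set.Icc (0 : ℝ) 1, HasDerivAt H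
      (q0 t * (s * (s + 1) * (s + 2) * (s + 3) * P (-s - 4) t)) t := by
    intro t ht
    have dP : ∀ c, HasDerivAt (P c) (c * P (c - 1) t) t := fun c => pow_der n hn c t ht.1
    have := (((((dq0 t).mul ((dP (-s - 3)).const_mul (-(s * (s + 1) * (s + 2))))).sub
      ((dq1 t).mul ((dP (-s - 2)).const_mul (s * (s + 1))))).add
      ((dq2 t).mul ((dP (-s - 1)).const_mul (-s)))).sub ((dq3 t).mul (dP (-s)))).add
      ((dP (1 - s)).div_const (1 - s))
    refine this.congr_deriv ?_
    rw [show -s - 3 - 1 = -s - 4 by ring, show -s - 2 - 1 = -s - 3 by ring,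
      show -s - 1 - 1 = -s - 2 by ring, show 1 - s - 1 = -s by ring, mul_div_assoc,
      mul_div_assoc']
    field_simp
    ring
  have bound : ∀ t ∈ Set.Ico (0 : ℝ) 1,
      ‖q0 t * (s * (s + 1) * (s + 2) * (s + 3) * P (-s - 4) t)‖ ≤
      ‖s * (s + 1) * (s + 2) * (s + 3)‖ * (n : ℝ) ^ (-s.re - 4) := by
    intro t ht
    have e1 : ‖q0 t‖ ≤ 1 := by
      have : q0 t = (((t ^ 2 * (1 - t) ^ 2) / 24 : ℝ) : ℂ) := by
        simp only [q0]; push_cast; ring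
      rw [this, Complex.norm_real, Real.norm_of_nonneg (by positivity)]
      have h1 : t ^ 2 ≤ 1 := by nlinarith [ht.1, ht.2]
      have h2 : (1 - t) ^ 2 ≤ 1 := by nlinarith [ht.1, ht.2]
      have : t ^ 2 * (1 - t) ^ 2 ≤ 1 := mul_le_one₀ h1 (by positivity) h2
      linarith
    have e2 : ‖P (-s - 4) t‖ ≤ (n : ℝ) ^ (-s.re - 4) := by
      have h0 : (0 : ℝ) < n + t := by linarith [ht.1]
      have : P (-s - 4) t = ((n + t : ℝ) : ℂ) ^ (-s - 4) := by simp [P]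
      rw [this, Complex.norm_cpow_eq_rpow_re_of_pos h0]
      have : (-s - 4).re = -s.re - 4 := by simp
      rw [this]
      exact Real.rpow_le_rpow_of_nonpos hn' (by linarith [ht.1]) (by linarith)
    rw [norm_mul, norm_mul (s * (s + 1) * (s + 2) * (s + 3))]
    calc _ ≤ 1 * (‖s * (s + 1) * (s + 2) * (s + 3)‖ * (n : ℝ) ^ (-s.re - 4)) := by gcongr
      _ = _ := one_mul _
  have main := norm_image_sub_le_of_norm_deriv_le_segment_01'
    (fun t ht => (dH t ht).hasDerivWithinAt) bound
  have key : H 1 - H 0 = -(EM s (n + 1) - EM s n) := by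
    simp only [H, P, q0, q1, q2, q3, EM, Finset.sum_Icc_succ_top (show 1 ≤ n + 1 by omega)]
    push_cast
    simp only [add_zero]
    ring
  rwa [key, norm_neg] at main

open Filter Topology

lemma EM_tendsto_of_one_lt (s : ℂ) (hs : 1 < s.re) :
    Tendsto (EM s) atTop (𝓝 (riemannZeta s)) := by
  have hz : ∀ c : ℂ, c.re < 0 → Tendsto (fun n : ℕ => (n : ℂ) ^ c) atTop (𝓝 0) := by
    intro c hc
    rw [tendsto_zero_iff_norm_tendsto_zero]
    have h1 : Tendsto (fun n : ℕ => (n : ℝ) ^ (-(-c.re))) atTop (𝓝 0) :=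
      (tendsto_rpow_neg_atTop (by linarith)).comp tendsto_natCast_atTop_atTop
    refine h1.congr' ?_
    filter_upwards [eventually_gt_atTop 0] with n hn
    rw [Complex.norm_natCast_cpow_of_pos hn, neg_neg]
  have hsum : Tendsto (fun n : ℕ => ∑ k ∈ Finset.Icc 1 n, (k : ℂ) ^ (-s)) atTop
      (𝓝 (riemannZeta s)) := by
    have h0 : Summable (fun n : ℕ => 1 / (n : ℂ) ^ s) := Complex.summable_one_div_nat_cpow.mpr hs
    have h1 := h0.hasSum
    rw [← zeta_eq_tsum_one_div_nat_cpow hs] at h1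
    have h2 := h1.tendsto_sum_nat.comp (tendsto_add_atTop_nat 1)
    refine h2.congr fun n => ?_
    have hs0 : s ≠ 0 := Complex.ne_zero_of_one_lt_re hs
    simp only [Function.comp]
    induction n with
    | zero => simp [Complex.zero_cpow hs0]
    | succ n ih =>
      rw [Finset.sum_range_succ, ih, Finset.sum_Icc_succ_top (by omega), Complex.cpow_neg, one_div]
  have h1 := hz (-s) (by simp; linarith)
  have h2 := hz (1 - s) (by simp; linarith)
  have h3 := hz (-s - 1) (by simp; linarith)
  have := ((hsum.sub (h1.div_const 2)).sub (h2.div_const (1 - s))).add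
    ((h3.const_mul s).div_const 12)
  simp only [zero_div, mul_zero, sub_zero, add_zero] at this
  exact this

def Wset : Set ℂ := {s | -2 < s.re} ∩ Metric.ball 0 4
def Uset : Set ℂ := (Wset ∩ {s | s.re < 1}) ∪ (Wset ∩ {s | 0 < s.im})

lemma Wconv : Convex ℝ Wset := (convex_halfSpace_re_gt _).inter (convex_ball _ _)
lemma Wopen : IsOpen Wset :=
  (isOpen_lt continuous_const Complex.continuous_re).inter Metric.isOpen_ball
lemma Uopen : IsOpen Uset :=
  (Wopen.inter (isOpen_lt Complex.continuous_re continuous_const)).union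
    (Wopen.inter (isOpen_lt continuous_const Complex.continuous_im))
lemma Upre : IsPreconnected Uset := by
  refine IsPreconnected.union Complex.I ?_ ?_
    (Wconv.inter (convex_halfSpace_re_lt _)).isPreconnected
    (Wconv.inter (convex_halfSpace_im_gt _)).isPreconnected
  all_goals simp [Wset]
lemma Une {s : ℂ} (h : s ∈ Uset) : s ≠ 1 := by
  rintro rfl
  simp [Uset] at h
lemma UW {s : ℂ} (h : s ∈ Uset) : s ∈ Wset := by
  rcases h with h | h <;> exact h.1

lemma EM_diff (n : ℕ) (hn : 0 < n) : DifferentiableOn ℂ (fun s => EM s n) Uset := by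
  intro s hs
  have h1 : (1 : ℂ) - s ≠ 0 := sub_ne_zero.mpr (Une hs).symm
  refine DifferentiableAt.differentiableWithinAt ?_
  have hp : ∀ k : ℕ, 0 < k → ∀ f : ℂ → ℂ, DifferentiableAt ℂ f s →
      DifferentiableAt ℂ (fun s => (k : ℂ) ^ (f s)) s := by
    intro k hk f hf
    exact hf.const_cpow (Or.inl (by exact_mod_cast hk.ne'))
  unfold EM
  refine (((DifferentiableAt.fun_sum fun k hk => ?_).sub ((hp n hn _ ?_).div_const 2)).sub
    ((hp n hn _ ?_).div ?_ h1)).add (((differentiableAt_id).mul (hp n hn _ ?_)).div_const 12)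
  · exact hp k (Finset.mem_Icc.mp hk).1 _ (by fun_prop)
  all_goals fun_prop

lemma EM_step_W {s : ℂ} (hs : s ∈ Uset) (n : ℕ) :
    ‖EM s (n + 1 + 1) - EM s (n + 1)‖ ≤ 840 * (1 / ((n + 1 : ℕ) : ℝ) ^ 2) := by
  obtain ⟨hre, hb⟩ := UW hs
  simp only [Set.mem_ofPred_eq, mem_ball_zero_iff] at hre hb
  refine (EM_step s (Une hs) (by linarith) (n + 1) (by omega)).trans ?_
  have hb1 : ‖s + 1‖ ≤ 5 := (norm_add_le _ _).trans (by simp; linarith)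
  have hb2 : ‖s + 2‖ ≤ 6 := (norm_add_le _ _).trans (by simp; linarith)
  have hb3 : ‖s + 3‖ ≤ 7 := (norm_add_le _ _).trans (by simp; linarith)
  have e : ((n + 1 : ℕ) : ℝ) ^ (-s.re - 4) ≤ 1 / ((n + 1 : ℕ) : ℝ) ^ 2 := by
    rw [one_div, ← Real.rpow_natCast, ← Real.rpow_neg (by positivity)]
    refine Real.rpow_le_rpow_of_exponent_le (by simp) ?_
    push_cast; linarith
  rw [norm_mul, norm_mul, norm_mul]
  calc _ ≤ 4 * 5 * 6 * 7 * (1 / ((n + 1 : ℕ) : ℝ) ^ 2) := by gcongr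
    _ = _ := by norm_num

lemma EM_tendsto {s : ℂ} (hs : s ∈ Uset) : Tendsto (EM s) atTop (𝓝 (riemannZeta s)) := by
  have hu : Summable (fun n : ℕ => 840 * (1 / ((n + 1 : ℕ) : ℝ) ^ 2)) :=
    ((summable_nat_add_iff 1).mpr (Real.summable_one_div_nat_pow.mpr one_lt_two)).mul_left 840
  let G : ℂ → ℂ := fun s => EM s 1 + ∑' n : ℕ, (EM s (n + 1 + 1) - EM s (n + 1))
  have hG : ∀ s ∈ Uset, Tendsto (EM s) atTop (𝓝 (G s)) := by
    intro s hs
    have h1 : Summable (fun n : ℕ => EM s (n + 1 + 1) - EM s (n + 1)) :=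
      Summable.of_norm_bounded hu (EM_step_W hs)
    have h2 := (h1.hasSum.tendsto_sum_nat).const_add (EM s 1)
    rw [← tendsto_add_atTop_iff_nat 1]
    refine h2.congr fun n => ?_
    rw [Finset.sum_range_sub (fun n => EM s (n + 1))]
    ring
  have hGd : DifferentiableOn ℂ G Uset :=
    (EM_diff 1 one_pos).add (Complex.differentiableOn_tsum_of_summable_norm hu
      (fun n => (EM_diff _ (by omega)).sub (EM_diff _ (by omega))) Uopen
      (fun n s hs => EM_step_W hs n))
  have hzd : DifferentiableOn ℂ riemannZeta Uset := fun s hs =>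
    (differentiableAt_riemannZeta (Une hs)).differentiableWithinAt
  have h2 : (2 + Complex.I) ∈ Uset := by
    right
    refine ⟨⟨by simp, ?_⟩, by simp⟩
    rw [mem_ball_zero_iff]
    refine (norm_add_le _ _).trans_lt (by simp; norm_num)
  have := (hGd.analyticOnNhd Uopen).eqOn_of_preconnected_of_eventuallyEq
    (hzd.analyticOnNhd Uopen) Upre h2 (by
      have hV : IsOpen {s : ℂ | 1 < s.re} := isOpen_lt continuous_const Complex.continuous_re
      filter_upwards [Uopen.mem_nhds h2, hV.mem_nhds (by simp)] with z hz hz1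
      exact tendsto_nhds_unique (hG z hz) (EM_tendsto_of_one_lt z hz1))
  rw [← this hs]
  exact hG s hs

lemma tele (a : ℝ) (ha : 1 ≤ a) (n : ℕ) (hn : 0 < n) :
    (n : ℝ) ^ (-a - 1) ≤ 2 ^ a * ((n : ℝ) ^ (-a) - ((n + 1 : ℕ) : ℝ) ^ (-a)) := by
  have hn' : (1 : ℝ) ≤ n := by exact_mod_cast hn
  have hp : (0 : ℝ) < n := by linarith
  have e1 : (n : ℝ) ^ (-a) = (((n + 1 : ℕ) : ℝ)) ^ (-a) * (1 + 1 / (n : ℝ)) ^ a := by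
    have : ((n + 1 : ℕ) : ℝ) = n * (1 + 1 / (n : ℝ)) := by push_cast; field_simp
    rw [this, Real.mul_rpow hp.le (by positivity), mul_assoc, ← Real.rpow_add (by positivity)]
    simp
  have e2 : 1 + 1 / (n : ℝ) ≤ (1 + 1 / (n : ℝ)) ^ a :=
    Real.self_le_rpow_of_one_le (by simp) ha
  have e3 : (n : ℝ) ^ (-a) ≤ 2 ^ a * ((n + 1 : ℕ) : ℝ) ^ (-a) := by
    have : (2 * (n : ℝ)) ^ (-a) ≤ ((n + 1 : ℕ) : ℝ) ^ (-a) :=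
      Real.rpow_le_rpow_of_nonpos (by positivity) (by push_cast; linarith) (by linarith)
    calc (n : ℝ) ^ (-a) = 2 ^ a * (2 * (n : ℝ)) ^ (-a) := by
          rw [Real.mul_rpow (by norm_num) hp.le, ← mul_assoc, ← Real.rpow_add (by norm_num)]
          simp
      _ ≤ _ := by gcongr
  calc (n : ℝ) ^ (-a - 1) = (n : ℝ) ^ (-a) * (1 / n) := by
        rw [Real.rpow_sub_one hp.ne']; ring
    _ ≤ 2 ^ a * ((n + 1 : ℕ) : ℝ) ^ (-a) * (1 / n) := by gcongr
    _ = 2 ^ a * (((n + 1 : ℕ) : ℝ) ^ (-a) * (1 + 1 / (n : ℝ)) - ((n + 1 : ℕ) : ℝ) ^ (-a)) := by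
        ring
    _ ≤ _ := by rw [e1]; gcongr

lemma EM_err (s : ℂ) (hs : s ∈ Uset) (N : ℕ) (hN : 0 < N) :
    ‖EM s N - riemannZeta s‖ ≤
      ‖s * (s + 1) * (s + 2) * (s + 3)‖ * 2 ^ (s.re + 3) * (N : ℝ) ^ (-(s.re + 3)) := by
  have hre : -2 < s.re := (UW hs).1
  set K := ‖s * (s + 1) * (s + 2) * (s + 3)‖ with hK
  set a := s.re + 3 with ha
  have key : ∀ M, N ≤ M → ‖EM s N - EM s M‖ ≤
      K * 2 ^ a * ((N : ℝ) ^ (-a) - (M : ℝ) ^ (-a)) := by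
    intro M hM
    induction M, hM using Nat.le_induction with
    | base => simp
    | succ M hM ih =>
      have h1 := EM_step s (Une hs) (by linarith) M (by omega)
      have h2 := tele a (by linarith) M (by omega)
      rw [show -s.re - 4 = -a - 1 by rw [ha]; ring] at h1
      have h3 : K * (M : ℝ) ^ (-a - 1) ≤
        K * (2 ^ a * ((M : ℝ) ^ (-a) - ((M + 1 : ℕ) : ℝ) ^ (-a))) := by gcongr
      have h4 := norm_sub_le (EM s N - EM s M) (EM s (M + 1) - EM s M)
      rw [show EM s N - EM s M - (EM s (M + 1) - EM s M) = EM s N - EM s (M + 1) by ring] at h4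
      nlinarith
  refine le_of_tendsto ((tendsto_const_nhds.sub (EM_tendsto hs)).norm) ?_
  filter_upwards [eventually_ge_atTop N] with M hM
  refine (key M hM).trans ?_
  gcongr
  have : (0 : ℝ) ≤ (M : ℝ) ^ (-a) := by positivity
  linarith

theorem trapezoid_expansion_pow_one_add_alpha (α x : ℝ) (hα0 : 0 < α) (hα1 : α < 1)
    (hx : 0 < x) :
    ∃ C > 0, ∀ N : ℕ, 0 < N → ∀ h : ℝ, h = x / N →
      |h ^ (2 + α) * (∑ k ∈ Finset.Icc 1 N, (k : ℝ) ^ (1 + α)) -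
          (x ^ (1 + α) / 2) * h -
        (x ^ (2 + α) / (2 + α) + ((1 + α) * x ^ α / 12) * h ^ 2 +
          zetaR (-1 - α) * h ^ (2 + α))| ≤ C * h ^ 4 := by
  set s : ℂ := ((-1 - α : ℝ) : ℂ) with hsdef
  have hsre : s.re = -1 - α := Complex.ofReal_re _
  have hsU : s ∈ Uset := by
    left
    refine ⟨⟨?_, ?_⟩, ?_⟩
    · simp only [Set.mem_ofPred_eq, hsre]; linarith
    · rw [mem_ball_zero_iff, hsdef, Complex.norm_real, Real.norm_eq_abs, abs_lt]
      constructor <;> linarith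
    · simp only [Set.mem_ofPred_eq, hsre]; linarith
  set K : ℝ := ‖s * (s + 1) * (s + 2) * (s + 3)‖ * 2 ^ (s.re + 3) with hK
  have hK0 : 0 ≤ K := by positivity
  refine ⟨(K + 1) * x ^ (α - 2), by positivity, ?_⟩
  intro N hN h hh
  have hN' : (0 : ℝ) < N := by exact_mod_cast hN
  have hh0 : 0 < h := by rw [hh]; positivity
  have hxN : x = h * N := by rw [hh]; field_simp
  let e : ℝ := ∑ k ∈ Finset.Icc 1 N, (k : ℝ) ^ (1 + α) - (N : ℝ) ^ (1 + α) / 2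
    - (N : ℝ) ^ (2 + α) / (2 + α) - (1 + α) * (N : ℝ) ^ α / 12
  have hEM : EM s N = (e : ℂ) := by
    have hc : ∀ (k : ℕ) (r : ℝ), (((k : ℝ) ^ r : ℝ) : ℂ) = (k : ℂ) ^ (r : ℂ) := by
      intro k r
      rw [Complex.ofReal_cpow (by positivity)]; simp
    simp only [EM, e]
    push_cast
    simp only [hc]
    rw [show -s = ((1 + α : ℝ) : ℂ) by rw [hsdef]; push_cast; ring,
      show 1 - s = ((2 + α : ℝ) : ℂ) by rw [hsdef]; push_cast; ring,
      show ((1 + α : ℝ) : ℂ) - 1 = (α : ℂ) by push_cast; ring, hsdef]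
    push_cast
    ring
  have herr : |e - zetaR (-1 - α)| ≤ K * (N : ℝ) ^ (α - 2) := by
    have h1 := EM_err s hsU N hN
    rw [hEM, hsre, show -(-1 - α + 3) = α - 2 by ring] at h1
    have h2 := (Complex.abs_re_le_norm _).trans h1
    rw [Complex.sub_re, Complex.ofReal_re] at h2
    simpa only [hK, hsre, zetaR] using h2
  have p0 : h ^ (2 + α) = h ^ 2 * h ^ α := by
    rw [Real.rpow_add hh0]; simp
  have p1 : h ^ (1 + α) = h * h ^ α := by
    rw [Real.rpow_add hh0]; simp
  have hexp : h ^ (2 + α) * (∑ k ∈ Finset.Icc 1 N, (k : ℝ) ^ (1 + α)) -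
          (x ^ (1 + α) / 2) * h -
        (x ^ (2 + α) / (2 + α) + ((1 + α) * x ^ α / 12) * h ^ 2 +
          zetaR (-1 - α) * h ^ (2 + α)) = h ^ (2 + α) * (e - zetaR (-1 - α)) := by
    rw [hxN, Real.mul_rpow hh0.le hN'.le, Real.mul_rpow hh0.le hN'.le,
      Real.mul_rpow hh0.le hN'.le, p0, p1]
    simp only [e]
    ring
  have hfin : h ^ (2 + α) * (N : ℝ) ^ (α - 2) = x ^ (α - 2) * h ^ 4 := by
    rw [hxN, Real.mul_rpow hh0.le hN'.le, show (2 + α) = (α - 2) + (4 : ℕ) by push_cast; ring,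
      Real.rpow_add hh0, Real.rpow_natCast]
    ring
  rw [hexp, abs_mul, abs_of_pos (by positivity)]
  calc h ^ (2 + α) * |e - zetaR (-1 - α)| ≤ h ^ (2 + α) * (K * (N : ℝ) ^ (α - 2)) := by gcongr
    _ = K * (x ^ (α - 2) * h ^ 4) := by rw [← hfin]; ring
    _ ≤ (K + 1) * (x ^ (α - 2) * h ^ 4) := by gcongr; linarith
    _ = _ := by ring
end

section
/- Let 0 < α < 1, x > 0, let p be a real polynomial, and set z(t) = (x−t)^α p(t). Then there exists a constant C > 0 such that for every positive integer N, with h = x/N, the trapezoidal sum T_h[z] = h( z(0)/2 + ∑_{k=1}^{N−1} z(kh) ) satisfies |T_h[z] − ( J^α p(x) + p(x) ζ(−α) h^{1+α} − (z′(0)/12) h² − p′(x) ζ(−1−α) h^{2+α} + (p″(x)/2) ζ(−2−α) h^{3+α} )| ≤ C h⁴, where z′(0) = −α x^{α−1} p(0) + x^{α} p′(0). -/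
/-- Partial Euler-Maclaurin sum for zeta, multiplied by `s - 1`. -/
noncomputable def GG (s : ℂ) (m : ℕ) : ℂ :=
  (s - 1) * (∑ j ∈ Finset.range m, (((j : ℝ) + 1 : ℝ) : ℂ) ^ (-s)
    + (((m : ℝ) + 1 : ℝ) : ℂ) ^ (-s) / 2
    + s / 12 * (((m : ℝ) + 1 : ℝ) : ℂ) ^ (-s - 1)) + (((m : ℝ) + 1 : ℝ) : ℂ) ^ (1 - s)

lemma hda_cpow (c : ℂ) (t : ℝ) (ht : 0 < t) :
    HasDerivAt (fun y : ℝ => (y : ℂ) ^ c) (c * (t : ℂ) ^ (c - 1)) t := by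
  by_cases hc : c = 0
  · subst hc
    simpa using hasDerivAt_const t (1 : ℂ)
  · exact hasDerivAt_ofReal_cpow_const ht.ne' hc

lemma rpow_cmp (c : ℝ) (n t : ℝ) (hn : 0 < n) (ht : 0 < t) (h1 : t ≤ 2 * n) (h2 : n ≤ 2 * t) :
    t ^ c ≤ 2 ^ |c| * n ^ c := by
  rcases le_or_gt 0 c with hc | hc
  · rw [abs_of_nonneg hc, ← Real.mul_rpow (by norm_num) hn.le]
    exact Real.rpow_le_rpow ht.le h1 hc
  · rw [abs_of_neg hc]
    have : (n / 2) ^ c = 2 ^ (-c) * n ^ c := by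
      rw [Real.div_rpow hn.le (by norm_num), Real.rpow_neg (by norm_num)]
      field_simp
    rw [← this]
    exact Real.rpow_le_rpow_of_nonpos (by positivity) (by linarith) hc.le

lemma GG_step (s : ℂ) (m : ℕ) :
    ‖GG s (m + 1) - GG s m‖ ≤ ‖(s - 1) * (s * (s + 1) * (s + 2) * (s + 3))‖ *
      (2 ^ |-s.re - 4| * ((m : ℝ) + 1) ^ (-s.re - 4)) := by
  set n : ℝ := (m : ℝ) + 1 with hn
  have hn0 : 0 < n := by positivity
  have hn1 : 1 ≤ n := by rw [hn]; linarith [(Nat.cast_nonneg m : (0 : ℝ) ≤ m)]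
  set H : ℝ → ℂ := fun t =>
    (s - 1) * ((((t - n) ^ 2 - 2 * (t - n) ^ 3 + (t - n) ^ 4) / 24 : ℝ)
        * (-(s * (s + 1) * (s + 2)) * (t : ℂ) ^ (-s - 3))
      - (((2 * (t - n) - 6 * (t - n) ^ 2 + 4 * (t - n) ^ 3) / 24 : ℝ) : ℂ)
        * ((s * (s + 1)) * (t : ℂ) ^ (-s - 2))
      + (((2 - 12 * (t - n) + 12 * (t - n) ^ 2) / 24 : ℝ) : ℂ) * (-s * (t : ℂ) ^ (-s - 1))
      - (((-12 + 24 * (t - n)) / 24 : ℝ) : ℂ) * (t : ℂ) ^ (-s)) - (t : ℂ) ^ (1 - s) with hH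
  set H' : ℝ → ℂ := fun t => (s - 1) * (s * (s + 1) * (s + 2) * (s + 3)) *
    ((((t - n) ^ 2 - 2 * (t - n) ^ 3 + (t - n) ^ 4) / 24 : ℝ) * (t : ℂ) ^ (-s - 4)) with hH'
  have hder : ∀ t ∈ Set.Icc n (n + 1), HasDerivWithinAt H (H' t) (Set.Icc n (n + 1)) t := by
    intro t ht
    have ht0 : 0 < t := lt_of_lt_of_le hn0 ht.1
    apply HasDerivAt.hasDerivWithinAt
    have hu : HasDerivAt (fun t : ℝ => t - n) 1 t := (hasDerivAt_id t).sub_const n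
    have e0 : HasDerivAt (fun t : ℝ => (((t - n) ^ 2 - 2 * (t - n) ^ 3 + (t - n) ^ 4) / 24 : ℝ))
        ((2 * (t - n) - 6 * (t - n) ^ 2 + 4 * (t - n) ^ 3) / 24) t := by
      refine ((((hu.pow 2).sub ((hu.pow 3).const_mul 2)).add (hu.pow 4)).div_const 24).congr_deriv ?_
      norm_num; ring
    have e1 : HasDerivAt (fun t : ℝ => ((2 * (t - n) - 6 * (t - n) ^ 2 + 4 * (t - n) ^ 3) / 24 : ℝ))
        ((2 - 12 * (t - n) + 12 * (t - n) ^ 2) / 24) t := by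
      refine ((((hu.const_mul 2).sub ((hu.pow 2).const_mul 6)).add
        ((hu.pow 3).const_mul 4)).div_const 24).congr_deriv ?_
      norm_num; ring
    have e2 : HasDerivAt (fun t : ℝ => ((2 - 12 * (t - n) + 12 * (t - n) ^ 2) / 24 : ℝ))
        ((-12 + 24 * (t - n)) / 24) t := by
      refine ((((hu.const_mul 12).const_sub 2).add
        ((hu.pow 2).const_mul 12)).div_const 24).congr_deriv ?_
      norm_num; ring
    have e3 : HasDerivAt (fun t : ℝ => ((-12 + 24 * (t - n)) / 24 : ℝ)) 1 t := by
      refine (((hu.const_mul 24).const_add (-12)).div_const 24).congr_deriv ?_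
      norm_num
    have c3 := (hda_cpow (-s - 3) t ht0).const_mul (-(s * (s + 1) * (s + 2)))
    have c2 := (hda_cpow (-s - 2) t ht0).const_mul (s * (s + 1))
    have c1 := (hda_cpow (-s - 1) t ht0).const_mul (-s)
    have c0 := (hda_cpow (-s) t ht0)
    have cF := (hda_cpow (1 - s) t ht0)
    refine ((((((e0.ofReal_comp.mul c3).sub (e1.ofReal_comp.mul c2)).add
      (e2.ofReal_comp.mul c1)).sub (e3.ofReal_comp.mul c0)).const_mul (s - 1)).sub cF).congr_deriv ?_
    rw [hH']
    have x1 : -s - 3 - 1 = -s - 4 := by ring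
    have x2 : -s - 2 - 1 = -s - 3 := by ring
    have x3 : -s - 1 - 1 = -s - 2 := by ring
    have x4 : 1 - s - 1 = -s := by ring
    simp only [x1, x2, x3, x4]
    push_cast
    ring
  have hbd : ∀ t ∈ Set.Icc n (n + 1), ‖H' t‖ ≤ ‖(s - 1) * (s * (s + 1) * (s + 2) * (s + 3))‖ *
      (2 ^ |-s.re - 4| * n ^ (-s.re - 4)) := by
    intro t ht
    have ht0 : 0 < t := lt_of_lt_of_le hn0 ht.1
    rw [hH']
    simp only
    rw [norm_mul]
    refine mul_le_mul_of_nonneg_left ?_ (norm_nonneg _)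
    rw [norm_mul, Complex.norm_cpow_eq_rpow_re_of_pos ht0, Complex.norm_real, Real.norm_eq_abs]
    have h1 : |((t - n) ^ 2 - 2 * (t - n) ^ 3 + (t - n) ^ 4) / 24| ≤ 1 := by
      obtain ⟨a, b⟩ := ht
      have q : ((t - n) ^ 2 - 2 * (t - n) ^ 3 + (t - n) ^ 4) / 24
        = ((t - n) * (1 - (t - n))) ^ 2 / 24 := by ring
      have q1 : 0 ≤ (t - n) * (1 - (t - n)) := mul_nonneg (by linarith) (by linarith)
      have q2 : (t - n) * (1 - (t - n)) ≤ 1 := by nlinarith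
      rw [q, abs_of_nonneg (by positivity)]
      nlinarith
    have h2 := rpow_cmp (-s.re - 4) n t hn0 ht0 (by linarith [ht.2]) (by linarith [ht.1])
    have hre : (-s - 4).re = -s.re - 4 := by simp
    rw [hre]
    calc _ ≤ 1 * t ^ (-s.re - 4) := by
          apply mul_le_mul_of_nonneg_right h1 (by positivity)
      _ ≤ _ := by rw [one_mul]; exact h2
  have := Convex.norm_image_sub_le_of_norm_hasDerivWithin_le hder hbd (convex_Icc _ _)
    (x := n) (y := n + 1) (by simp) (by simp)
  have hfin : H (n + 1) - H n = -(GG s (m + 1) - GG s m) := by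
    rw [hH]
    simp only [GG, Finset.sum_range_succ, Nat.cast_add, Nat.cast_one, ← hn]
    push_cast
    ring
  rw [hfin, norm_neg] at this
  simpa using this

lemma cpow_tendsto_zero_s4 (c : ℂ) (hc : c.re < 0) :
    Filter.Tendsto (fun m : ℕ => (((m : ℝ) + 1 : ℝ) : ℂ) ^ c) Filter.atTop (nhds 0) := by
  rw [tendsto_zero_iff_norm_tendsto_zero]
  have : ∀ m : ℕ, ‖(((m : ℝ) + 1 : ℝ) : ℂ) ^ c‖ = ((m : ℝ) + 1) ^ (-(-c.re)) := by
    intro m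
    rw [Complex.norm_cpow_eq_rpow_re_of_pos (by positivity), neg_neg]
  simp only [this]
  exact (tendsto_rpow_neg_atTop (by linarith)).comp
    (Filter.tendsto_atTop_add_const_right _ _ tendsto_natCast_atTop_atTop)

lemma GG_tendsto_right (s : ℂ) (hs : 1 < s.re) :
    Filter.Tendsto (GG s) Filter.atTop (nhds (riemannZeta₁ s)) := by
  have hs1 : s ≠ 1 := by rintro rfl; simp at hs
  have hz : riemannZeta₁ s = (s - 1) * riemannZeta s := by
    rw [riemannZeta_eq_inv_sub_mul hs1]
    field_simp [sub_ne_zero.mpr hs1]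
  have hsum : Summable (fun n : ℕ => 1 / ((n : ℂ) + 1) ^ s) := by
    have := (Complex.summable_one_div_nat_cpow (p := s)).mpr hs
    have := (summable_nat_add_iff 1).mpr this
    simpa using this
  have ht := hsum.hasSum.tendsto_sum_nat
  rw [← zeta_eq_tsum_one_div_nat_add_one_cpow hs] at ht
  have ht' : Filter.Tendsto (fun m : ℕ => ∑ j ∈ Finset.range m, (((j : ℝ) + 1 : ℝ) : ℂ) ^ (-s))
      Filter.atTop (nhds (riemannZeta s)) := by
    refine ht.congr fun m => Finset.sum_congr rfl fun j _ => ?_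
    rw [Complex.cpow_neg]; push_cast; simp
  have := (((ht'.add ((cpow_tendsto_zero_s4 (-s) (by simp; linarith)).div_const 2)).add
    ((cpow_tendsto_zero_s4 (-s - 1) (by simp; linarith)).const_mul (s / 12))).const_mul (s - 1)).add
    (cpow_tendsto_zero_s4 (1 - s) (by simp; linarith))
  rw [hz]
  simp only [zero_div, mul_zero, add_zero] at this
  exact this

lemma GG_tendsto (s₀ : ℂ) (hs : -3 < s₀.re) :
    Filter.Tendsto (GG s₀) Filter.atTop (nhds (riemannZeta₁ s₀)) := by
  obtain ⟨δ, hδ0, hδ⟩ : ∃ δ : ℝ, 0 < δ ∧ -3 + δ < s₀.re := ⟨(s₀.re + 3) / 2, by linarith, by linarith⟩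
  obtain ⟨δ', hδ'0, hδ', hδ'1⟩ : ∃ δ' : ℝ, 0 < δ' ∧ -3 + δ' < s₀.re ∧ δ' < 1 :=
    ⟨min δ (1 / 2), by positivity, by linarith [min_le_left δ (1 / 2)],
      by linarith [min_le_right δ (1 / 2)]⟩
  set R : ℝ := ‖s₀‖ + 3 with hR
  have hR0 : 3 ≤ R := by rw [hR]; linarith [norm_nonneg s₀]
  set U : Set ℂ := Metric.ball 0 R ∩ {s | -3 + δ' < s.re} with hU
  have hUo : IsOpen U := Metric.isOpen_ball.inter (isOpen_lt continuous_const Complex.continuous_re)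
  have hUc : Convex ℝ U := (convex_ball _ _).inter (convex_halfSpace_re_gt _)
  have hs0U : s₀ ∈ U := ⟨by simp [hR], hδ'⟩
  have h2U : (2 : ℂ) ∈ U := ⟨by simp; linarith, by simp; linarith⟩
  set K : ℝ := (R + 1) * (R * (R + 1) * (R + 2) * (R + 3)) * 2 ^ (R + 4) with hK
  set u : ℕ → ℝ := fun m => K * ((m : ℝ) + 1) ^ (-1 - δ') with hu
  have hus : Summable u := by
    apply Summable.mul_left
    have := (summable_nat_add_iff 1).mpr (Real.summable_nat_rpow (p := -1 - δ').mpr (by linarith))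
    simpa using this
  have hbound : ∀ (m : ℕ) (w : ℂ), w ∈ U → ‖GG w (m + 1) - GG w m‖ ≤ u m := by
    intro m w hw
    refine (GG_step w m).trans ?_
    have hwR : ‖w‖ ≤ R := by have := hw.1; simp at this; exact this.le
    have hre : -3 + δ' < w.re := hw.2
    have hre' : |w.re| ≤ R := (Complex.abs_re_le_norm w).trans hwR
    have k1 : ‖w - 1‖ ≤ R + 1 := (norm_sub_le _ _).trans (by simpa using hwR)
    have k2 : ‖w + 1‖ ≤ R + 1 := (norm_add_le _ _).trans (by simpa using hwR)
    have k3 : ‖w + 2‖ ≤ R + 2 := (norm_add_le _ _).trans (by simpa using hwR)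
    have k4 : ‖w + 3‖ ≤ R + 3 := (norm_add_le _ _).trans (by simpa using hwR)
    have k5 : (2 : ℝ) ^ |-w.re - 4| ≤ 2 ^ (R + 4) := by
      apply Real.rpow_le_rpow_of_exponent_le (by norm_num)
      have := abs_le.mp hre'
      rw [abs_le]; constructor <;> linarith
    have k6 : ((m : ℝ) + 1) ^ (-w.re - 4) ≤ ((m : ℝ) + 1) ^ (-1 - δ') := by
      apply Real.rpow_le_rpow_of_exponent_le
      · linarith [(Nat.cast_nonneg m : (0 : ℝ) ≤ m)]
      · linarith
    rw [hu, hK]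
    simp only [norm_mul]
    rw [mul_assoc _ (2 ^ (R + 4)) _]
    gcongr
  have hGd : ∀ m : ℕ, DifferentiableOn ℂ (fun w => GG w m) U := by
    intro m
    have hne : ∀ j : ℕ, (((j : ℝ) + 1 : ℝ) : ℂ) ≠ 0 := by
      intro j; exact_mod_cast (by positivity : ((j : ℝ) + 1) ≠ 0)
    have hp : ∀ (j : ℕ) (f : ℂ → ℂ), Differentiable ℂ f →
        Differentiable ℂ (fun w => (((j : ℝ) + 1 : ℝ) : ℂ) ^ (f w)) := by
      intro j f hf
      exact hf.const_cpow (Or.inl (hne j))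
    have hA : Differentiable ℂ (fun w : ℂ => ∑ j ∈ Finset.range m, (((j : ℝ) + 1 : ℝ) : ℂ) ^ (-w)) :=
      Differentiable.fun_sum fun j _ => hp j _ (by fun_prop)
    have hB := hp m (fun w => -w) (by fun_prop)
    have hC := hp m (fun w => -w - 1) (by fun_prop)
    have hD := hp m (fun w => 1 - w) (by fun_prop)
    apply Differentiable.differentiableOn
    unfold GG
    exact ((differentiable_id.sub_const 1).mul ((hA.add (hB.div_const 2)).add
      ((differentiable_id.div_const 12).mul hC))).add hD
  have hTd : DifferentiableOn ℂ (fun w => GG w 0 + ∑' m : ℕ, (GG w (m + 1) - GG w m)) U :=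
    (hGd 0).add (Complex.differentiableOn_tsum_of_summable_norm hus
      (fun m => (hGd (m + 1)).sub (hGd m)) hUo hbound)
  have hlim : ∀ w ∈ U, Filter.Tendsto (GG w) Filter.atTop
      (nhds (GG w 0 + ∑' m : ℕ, (GG w (m + 1) - GG w m))) := by
    intro w hw
    have hsw : Summable (fun m : ℕ => GG w (m + 1) - GG w m) :=
      Summable.of_norm_bounded hus (fun m => hbound m w hw)
    have := (hsw.hasSum.tendsto_sum_nat).const_add (GG w 0)
    refine this.congr fun m => ?_
    rw [Finset.sum_range_sub]; ring
  have heq : Set.EqOn (fun w => GG w 0 + ∑' m : ℕ, (GG w (m + 1) - GG w m)) riemannZeta₁ U := by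
    refine AnalyticOnNhd.eqOn_of_preconnected_of_eventuallyEq (hTd.analyticOnNhd hUo)
      (differentiable_riemannZeta₁.differentiableOn.analyticOnNhd hUo) hUc.isPreconnected h2U ?_
    have hV : {s : ℂ | 1 < s.re} ∈ nhds (2 : ℂ) :=
      (isOpen_lt continuous_const Complex.continuous_re).mem_nhds (by simp)
    filter_upwards [hV, hUo.mem_nhds h2U] with w hw hwU
    exact tendsto_nhds_unique (hlim w hwU) (GG_tendsto_right w hw)
  have := hlim s₀ hs0U
  have e := heq hs0U
  simp only at e
  rwa [e] at this

lemma rpow_step (a : ℝ) (ha : a ≠ 0) (m : ℕ) :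
    ((m : ℝ) + 1) ^ (a - 1) ≤ 2 ^ |a - 1| * (((m : ℝ) + 1 + 1) ^ a - ((m : ℝ) + 1) ^ a) / a := by
  set n : ℝ := (m : ℝ) + 1 with hn
  have hn1 : 1 ≤ n := by rw [hn]; linarith [(Nat.cast_nonneg m : (0 : ℝ) ≤ m)]
  have hd : ∀ t : ℝ, 0 < t → HasDerivAt (fun t : ℝ => t ^ a) (a * t ^ (a - 1)) t := fun t ht =>
    Real.hasDerivAt_rpow_const (Or.inl ht.ne')
  obtain ⟨c, hc, e⟩ := exists_hasDerivAt_eq_slope (fun t : ℝ => t ^ a) (fun t => a * t ^ (a - 1))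
    (a := n) (b := n + 1) (by linarith)
    (fun t ht => (hd t (by linarith [ht.1])).continuousAt.continuousWithinAt)
    (fun t ht => hd t (by linarith [ht.1]))
  have h := rpow_cmp (a - 1) c n (by linarith [hc.1]) (by linarith) (by linarith [hc.1])
    (by linarith [hc.2])
  have e' : (n + 1) ^ a - n ^ a = a * c ^ (a - 1) := by
    rw [e]; simp
  rw [e']
  convert h using 1
  field_simp

/-- Real form. -/
noncomputable def gR (β : ℝ) (m : ℕ) : ℝ :=
  ∑ j ∈ Finset.range m, ((j : ℝ) + 1) ^ β + ((m : ℝ) + 1) ^ β / 2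
    - β / 12 * ((m : ℝ) + 1) ^ (β - 1) - ((m : ℝ) + 1) ^ (β + 1) / (β + 1)

lemma GG_real (β : ℝ) (hβ : 0 < β) (m : ℕ) :
    GG (-β : ℂ) m = ((-(β + 1) * gR β m : ℝ) : ℂ) := by
  have hp : ∀ (j : ℕ) (c : ℝ), (((j : ℝ) + 1 : ℝ) : ℂ) ^ (c : ℂ) = ((((j : ℝ) + 1) ^ c : ℝ) : ℂ) := by
    intro j c
    rw [Complex.ofReal_cpow (by positivity)]
  have hb : ((β : ℂ) + 1) ≠ 0 := by exact_mod_cast (by positivity : β + 1 ≠ 0)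
  have e1 : (-(-β : ℂ) - 1) = ((β - 1 : ℝ) : ℂ) := by push_cast; ring
  have e2 : (1 - (-β : ℂ)) = ((β + 1 : ℝ) : ℂ) := by push_cast; ring
  have e3 : (-(-β : ℂ)) = (β : ℂ) := by ring
  unfold GG gR
  rw [e1, e2, e3]
  simp only [hp]
  simp only [Complex.ofReal_mul, Complex.ofReal_sub, Complex.ofReal_add, Complex.ofReal_div,
    Complex.ofReal_sum, Complex.ofReal_neg, Complex.ofReal_one, Complex.ofReal_ofNat]
  field_simp
  ring

lemma gR_diff (β : ℝ) (hβ : 0 < β) (hβ3 : β ≠ 3) : ∃ C > 0, ∀ m k : ℕ,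
    |gR β (m + k) - gR β m| ≤
      C * ((((m + k : ℕ) : ℝ) + 1) ^ (β - 3) - ((m : ℝ) + 1) ^ (β - 3)) / (β - 3) := by
  set s : ℂ := (-β : ℂ) with hs
  set K : ℝ := ‖(s - 1) * (s * (s + 1) * (s + 2) * (s + 3))‖ * 2 ^ |β - 4| * 2 ^ |β - 4| with hK
  have hK0 : 0 ≤ K := by positivity
  have ha : β - 3 ≠ 0 := sub_ne_zero.mpr hβ3
  have step : ∀ m : ℕ, |gR β (m + 1) - gR β m| ≤
      (K + 1) * (((m : ℝ) + 1 + 1) ^ (β - 3) - ((m : ℝ) + 1) ^ (β - 3)) / (β - 3) := by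
    intro m
    have h1 := GG_step s m
    have h2 := rpow_step (β - 3) ha m
    have r : -s.re - 4 = β - 4 := by simp [hs]
    have r2 : β - 3 - 1 = β - 4 := by ring
    rw [r2] at h2
    rw [r, hs, GG_real β hβ, GG_real β hβ, ← Complex.ofReal_sub, Complex.norm_real, ← mul_sub,
      norm_mul, Real.norm_eq_abs, Real.norm_eq_abs, abs_neg, abs_of_pos (by linarith : 0 < β + 1),
      ← hs] at h1
    have h3 : 0 ≤ (((m : ℝ) + 1 + 1) ^ (β - 3) - ((m : ℝ) + 1) ^ (β - 3)) / (β - 3) := by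
      have : 0 ≤ 2 ^ |β - 4| * ((((m : ℝ) + 1 + 1) ^ (β - 3) - ((m : ℝ) + 1) ^ (β - 3)) / (β - 3)) := by
        rw [← mul_div_assoc]; exact le_trans (by positivity) h2
      exact nonneg_of_mul_nonneg_right this (by positivity)
    set q := (((m : ℝ) + 1 + 1) ^ (β - 3) - ((m : ℝ) + 1) ^ (β - 3)) / (β - 3) with hq
    rw [mul_div_assoc, ← hq]
    rw [mul_div_assoc, ← hq] at h2
    calc |gR β (m + 1) - gR β m| ≤ (β + 1) * |gR β (m + 1) - gR β m| := by
          nlinarith [abs_nonneg (gR β (m + 1) - gR β m)]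
      _ ≤ _ := h1
      _ ≤ ‖(s - 1) * (s * (s + 1) * (s + 2) * (s + 3))‖ * (2 ^ |β - 4| * (2 ^ |β - 4| * q)) := by
          gcongr
      _ = K * q := by rw [hK]; ring
      _ ≤ (K + 1) * q := by nlinarith
  refine ⟨K + 1, by linarith, fun m k => ?_⟩
  induction k with
  | zero => simp
  | succ k ih =>
    have h := step (m + k)
    have t := abs_sub_le (gR β (m + (k + 1))) (gR β (m + k)) (gR β m)
    rw [← add_assoc] at *
    refine t.trans ((add_le_add h ih).trans (le_of_eq ?_))
    push_cast
    ring

lemma gR_key (β : ℝ) (hβ : 0 < β) (hβ3 : β ≠ 3) : ∃ C > 0, ∀ m : ℕ,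
    |gR β m - (if β < 3 then zetaR (-β) else 0)| ≤ C * ((m : ℝ) + 1) ^ (β - 3) := by
  obtain ⟨C, hC, h⟩ := gR_diff β hβ hβ3
  rcases lt_or_gt_of_ne hβ3 with hb | hb
  · have hT := GG_tendsto (-β : ℂ) (by simpa using hb)
    have hne : (-β : ℂ) ≠ 1 := by
      intro hh
      have := congrArg Complex.re hh
      simp at this; linarith
    have hz : (riemannZeta₁ (-β : ℂ)).re = -(β + 1) * zetaR (-β) := by
      have e : riemannZeta₁ (-β : ℂ) = ((-(β + 1) : ℝ) : ℂ) * riemannZeta ((-β : ℝ) : ℂ) := by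
        push_cast
        rw [riemannZeta_eq_inv_sub_mul hne]
        have := sub_ne_zero.mpr hne
        field_simp
        ring
      rw [e, Complex.re_ofReal_mul, zetaR]
    have hT' : Filter.Tendsto (gR β) Filter.atTop (nhds (zetaR (-β))) := by
      have h1 := (Complex.continuous_re.tendsto _).comp hT
      rw [hz] at h1
      have h2 := h1.const_mul (-(β + 1))⁻¹
      have hb0 : (β + 1) ≠ 0 := by positivity
      have hb1 : -(β + 1) ≠ 0 := neg_ne_zero.mpr hb0
      rw [inv_mul_cancel_left₀ hb1] at h2
      refine h2.congr fun m => ?_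
      simp only [Function.comp, GG_real β hβ, Complex.ofReal_re]
      rw [inv_mul_cancel_left₀ hb1]
    refine ⟨C / (3 - β), div_pos hC (by linarith), fun m => ?_⟩
    rw [if_pos hb, abs_sub_comm]
    have hT2 : Filter.Tendsto (fun k => |gR β (m + k) - gR β m|) Filter.atTop
        (nhds |zetaR (-β) - gR β m|) := by
      have := hT'.comp (Filter.tendsto_add_atTop_nat m)
      refine ((this.sub_const _).abs).congr fun k => ?_
      simp [Function.comp, add_comm]
    refine le_of_tendsto' hT2 fun k => (h m k).trans ?_
    have p1 : 0 ≤ (((m + k : ℕ) : ℝ) + 1) ^ (β - 3) := by positivity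
    rw [← neg_sub 3 β, div_neg, ← neg_div, div_mul_eq_mul_div, neg_sub 3 β]
    have : 0 < 3 - β := by linarith
    gcongr
    nlinarith
  · refine ⟨|gR β 0| + C / (β - 3), ?_, fun m => ?_⟩
    · have : 0 < C / (β - 3) := div_pos hC (by linarith)
      positivity
    · rw [if_neg (by linarith), sub_zero]
      have h0 := h 0 m
      simp only [zero_add, Nat.cast_zero, Real.one_rpow] at h0
      have hp : 1 ≤ ((m : ℝ) + 1) ^ (β - 3) :=
        Real.one_le_rpow (by linarith [(Nat.cast_nonneg m : (0 : ℝ) ≤ m)]) (by linarith)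
      have t : |gR β m| ≤ |gR β 0| + |gR β m - gR β 0| := by
        have := abs_add_le (gR β 0) (gR β m - gR β 0)
        simpa using this
      have hq : 0 < C / (β - 3) := div_pos hC (by linarith)
      rw [mul_div_right_comm] at h0
      nlinarith [abs_nonneg (gR β 0)]

/-- The error of the expansion. -/
noncomputable def Err (α x : ℝ) (p : Polynomial ℝ) (N : ℕ) (h : ℝ) : ℝ :=
  h * ((x - 0) ^ α * p.eval 0 / 2 +
          ∑ k ∈ Finset.Icc 1 (N - 1), (x - (k : ℝ) * h) ^ α * p.eval ((k : ℝ) * h)) -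
        ((∫ t in (0:ℝ)..x, (x - t) ^ α * p.eval t) +
          p.eval x * zetaR (-α) * h ^ (1 + α) -
          ((-α * x ^ (α - 1) * p.eval 0 + x ^ α * p.derivative.eval 0) / 12) * h ^ 2 -
          p.derivative.eval x * zetaR (-1 - α) * h ^ (2 + α) +
          (p.derivative.derivative.eval x / 2) * zetaR (-2 - α) * h ^ (3 + α))

lemma Err_add (α x : ℝ) (hα0 : 0 < α) (p q : Polynomial ℝ) (N : ℕ) (h : ℝ) :
    Err α x (p + q) N h = Err α x p N h + Err α x q N h := by
  have hi : ∀ p : Polynomial ℝ, IntervalIntegrable (fun t => (x - t) ^ α * p.eval t)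
      MeasureTheory.volume 0 x := by
    intro p
    apply Continuous.intervalIntegrable
    exact ((continuous_const.sub continuous_id).rpow_const (fun _ => Or.inr hα0.le)).mul
      p.continuous
  have e : (∫ t in (0:ℝ)..x, (x - t) ^ α * (p + q).eval t) =
      (∫ t in (0:ℝ)..x, (x - t) ^ α * p.eval t) + ∫ t in (0:ℝ)..x, (x - t) ^ α * q.eval t := by
    rw [← intervalIntegral.integral_add (hi p) (hi q)]
    simp only [Polynomial.eval_add, mul_add]
  unfold Err
  rw [e]
  simp only [Polynomial.eval_add, Polynomial.derivative_add, mul_add, Finset.sum_add_distrib]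
  ring

lemma Err_mono (α x : ℝ) (hα0 : 0 < α) (hα1 : α < 1) (hx : 0 < x) (m : ℕ) (a : ℝ) :
    ∃ C > 0, ∀ N : ℕ, 0 < N → ∀ h : ℝ, h = x / N →
      |Err α x (Polynomial.C a * (Polynomial.X - Polynomial.C x) ^ m) N h| ≤ C * h ^ 4 := by
  set p := Polynomial.C a * (Polynomial.X - Polynomial.C x) ^ m with hp
  set β : ℝ := α + m with hβ
  have hβ0 : 0 < β := by positivity
  have hβ3 : β ≠ 3 := by
    intro hh
    have h1 : (m : ℝ) < 3 := by linarith
    have h2 : (2 : ℝ) < m := by linarith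
    have h1' : m < 3 := by exact_mod_cast h1
    have h2' : 2 < m := by exact_mod_cast h2
    omega
  obtain ⟨C, hC, hkey⟩ := gR_key β hβ0 hβ3
  set b : ℝ := a * (-1) ^ m with hb
  set zt : ℝ := if β < 3 then zetaR (-β) else 0 with hzt
  have hpe : ∀ t, p.eval t = b * (x - t) ^ m := by
    intro t
    rw [hp, hb]
    simp only [Polynomial.eval_mul, Polynomial.eval_C, Polynomial.eval_pow, Polynomial.eval_sub,
      Polynomial.eval_X]
    rw [mul_assoc, ← mul_pow]; ring_nf
  have hz : ∀ t, t ≤ x → (x - t) ^ α * p.eval t = b * (x - t) ^ β := by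
    intro t ht
    rw [hpe, hβ, Real.rpow_add_natCast' (by linarith) (by positivity)]
    ring
  have hint : (∫ t in (0:ℝ)..x, (x - t) ^ α * p.eval t) = b * (x ^ (β + 1) / (β + 1)) := by
    have : (∫ t in (0:ℝ)..x, (x - t) ^ α * p.eval t) = ∫ t in (0:ℝ)..x, b * (x - t) ^ β := by
      apply intervalIntegral.integral_congr
      intro t ht
      rw [Set.uIcc_of_le hx.le] at ht
      exact hz t ht.2
    rw [this, intervalIntegral.integral_const_mul,
      intervalIntegral.integral_comp_sub_left (fun t => t ^ β) x,
      integral_rpow (Or.inl (by linarith))]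
    simp [Real.zero_rpow (by linarith : β + 1 ≠ 0)]
  have hder : (-α * x ^ (α - 1) * p.eval 0 + x ^ α * p.derivative.eval 0) = -b * (β * x ^ (β - 1)) := by
    have e1 : x ^ (β - 1) = x ^ (α - 1) * x ^ m := by
      rw [← Real.rpow_add_natCast hx.ne']; congr 1; rw [hβ]; ring
    have e2 : x ^ α = x ^ (α - 1) * x := by
      rw [← Real.rpow_add_one hx.ne']; congr 1; ring
    rw [hpe, e1, e2, hp, hb, hβ]
    rcases m with _ | m
    · simp; ring
    · simp [Polynomial.derivative_pow]
      rw [neg_pow x m]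
      ring
  have hzeta : ∀ h : ℝ, p.eval x * zetaR (-α) * h ^ (1 + α) -
          p.derivative.eval x * zetaR (-1 - α) * h ^ (2 + α) +
          (p.derivative.derivative.eval x / 2) * zetaR (-2 - α) * h ^ (3 + α)
          = b * zt * h ^ (β + 1) := by
    intro h
    rw [hzt, hb, hp, hβ]
    rcases m with _ | _ | _ | m
    · rw [if_pos (by push_cast; linarith)]
      simp [add_comm]
    · rw [if_pos (by push_cast; linarith)]
      have e1 : (-(α + ((0 + 1 : ℕ) : ℝ))) = -1 - α := by push_cast; ring
      have e2 : (α + ((0 + 1 : ℕ) : ℝ)) + 1 = 2 + α := by push_cast; ring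
      rw [e1, e2]
      simp
    · rw [if_pos (by push_cast; linarith)]
      have e1 : (-(α + ((0 + 1 + 1 : ℕ) : ℝ))) = -2 - α := by push_cast; ring
      have e2 : (α + ((0 + 1 + 1 : ℕ) : ℝ)) + 1 = 3 + α := by push_cast; ring
      rw [e1, e2]
      simp [Polynomial.derivative_pow]
    · rw [if_neg (by push_cast; linarith [(Nat.cast_nonneg m : (0 : ℝ) ≤ m)])]
      simp [Polynomial.derivative_pow]
  refine ⟨(|b| + 1) * C * x ^ (β - 3), by positivity, ?_⟩
  intro N hN h hh
  obtain ⟨n, rfl⟩ : ∃ n, N = n + 1 := ⟨N - 1, by omega⟩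
  have hn0 : (0 : ℝ) < (n : ℝ) + 1 := by positivity
  have hxh : x = ((n : ℝ) + 1) * h := by rw [hh]; push_cast; field_simp
  have hh0 : 0 < h := by rw [hh]; positivity
  have hxp : ∀ c : ℝ, x ^ c = ((n : ℝ) + 1) ^ c * h ^ c := by
    intro c; rw [hxh, Real.mul_rpow hn0.le hh0.le]
  have hsum : ∑ k ∈ Finset.Icc 1 (n + 1 - 1), (x - (k : ℝ) * h) ^ α * p.eval ((k : ℝ) * h)
      = b * h ^ β * ∑ j ∈ Finset.range n, ((j : ℝ) + 1) ^ β := by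
    rw [← Finset.sum_range_reflect, Finset.mul_sum, add_tsub_cancel_right,
      ← Finset.Ico_add_one_right_eq_Icc, Finset.sum_Ico_eq_sum_range, add_tsub_cancel_right]
    refine Finset.sum_congr rfl fun i hi => ?_
    have hi' : i < n := Finset.mem_range.mp hi
    have hc : ((n - 1 - i : ℕ) : ℝ) = n - 1 - i := by
      rw [Nat.cast_sub (by omega), Nat.cast_sub (by omega)]; simp
    have hin : (i : ℝ) + 1 ≤ n := by exact_mod_cast hi'
    rw [hz _ (by rw [hxh]; push_cast; nlinarith)]
    have e : x - ((1 + i : ℕ) : ℝ) * h = ((n : ℝ) - 1 - i + 1) * h := by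
      rw [hxh]; push_cast; ring
    rw [e, hc, Real.mul_rpow (by linarith) hh0.le]
    ring
  have hE : Err α x p (n + 1) h = b * h ^ (β + 1) * (gR β n - zt) := by
    have e1 : h ^ (β + 1) = h ^ β * h := Real.rpow_add_one hh0.ne' _
    have e2 : h ^ β = h ^ (β - 1) * h := by
      rw [← Real.rpow_add_one hh0.ne']; congr 1; ring
    have h3 := hzeta h
    have h4 := hz 0 hx.le
    unfold Err
    rw [hsum, hint, hder, h4, sub_zero, hxp β, hxp (β + 1), hxp (β - 1), gR]
    rw [e1, e2] at *
    linear_combination -h3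
  have hk := hkey n
  rw [hE, abs_mul, abs_mul, abs_of_pos (by positivity : 0 < h ^ (β + 1))]
  have e3 : h ^ (β + 1) = h ^ (β - 3) * h ^ 4 := by
    rw [← Real.rpow_natCast h 4, ← Real.rpow_add hh0]; congr 1; push_cast; ring
  calc |b| * h ^ (β + 1) * |gR β n - zt| ≤ (|b| + 1) * h ^ (β + 1) * (C * ((n : ℝ) + 1) ^ (β - 3)) := by
        gcongr; linarith
    _ = (|b| + 1) * C * x ^ (β - 3) * h ^ 4 := by
        rw [hxp, e3]; ring

/-- Fourth-order expansion of the trapezoidal approximation of the fractional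
integral `J^α p(x) = ∫₀ˣ (x-t)^α p(t) dt` for a polynomial `p`, where
`z(t) = (x-t)^α p(t)` (note `z(x) = 0`), with
`z′(0) = -α x^{α-1} p(0) + x^α p′(0)`. -/
theorem trapezoid_expansion_polynomial (α x : ℝ) (hα0 : 0 < α) (hα1 : α < 1)
    (hx : 0 < x) (p : Polynomial ℝ) :
    ∃ C > 0, ∀ N : ℕ, 0 < N → ∀ h : ℝ, h = x / N →
      |h * ((x - 0) ^ α * p.eval 0 / 2 +
          ∑ k ∈ Finset.Icc 1 (N - 1), (x - (k : ℝ) * h) ^ α * p.eval ((k : ℝ) * h)) -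
        ((∫ t in (0:ℝ)..x, (x - t) ^ α * p.eval t) +
          p.eval x * zetaR (-α) * h ^ (1 + α) -
          ((-α * x ^ (α - 1) * p.eval 0 + x ^ α * p.derivative.eval 0) / 12) * h ^ 2 -
          p.derivative.eval x * zetaR (-1 - α) * h ^ (2 + α) +
          (p.derivative.derivative.eval x / 2) * zetaR (-2 - α) * h ^ (3 + α))|
        ≤ C * h ^ 4 := by
  suffices H : ∃ C > 0, ∀ N : ℕ, 0 < N → ∀ h : ℝ, h = x / N → |Err α x p N h| ≤ C * h ^ 4 from H
  rw [← Polynomial.sum_taylor_eq p x, Polynomial.sum_def]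
  refine Finset.sum_induction _ (fun q => ∃ C > 0, ∀ N : ℕ, 0 < N → ∀ h : ℝ, h = x / N →
    |Err α x q N h| ≤ C * h ^ 4) ?_ ?_ ?_
  · rintro q r ⟨C, hC, h1⟩ ⟨D, hD, h2⟩
    refine ⟨C + D, by linarith, fun N hN h hh => ?_⟩
    rw [Err_add α x hα0, add_mul]
    exact (abs_add_le _ _).trans (add_le_add (h1 N hN h hh) (h2 N hN h hh))
  · refine ⟨1, one_pos, fun N hN h hh => ?_⟩
    simp [Err]
    positivity
  · intro m _
    exact Err_mono α x hα0 hα1 hx m _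
end
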